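/- arXiv:0710.0046 — 3 statements merged into one kernel-verified Lean document; each statement's English description precedes it below -/
import Mathlib

section
/- Let p be a prime and C an association scheme such that (1) C has at least two distinct maximal scheme equivalences, and (2) for every nontrivial block X of C the restricted scheme C_X is a p-scheme. Then C is a p-scheme. -/
open Set Function

section Defs

variable {V : Type*}

/-- The diagonal relation on `V`. -/
def diag (V : Type*) : Set (V × V) := {x | x.1 = x.2}

/-- The transpose of a relation. -/
def transp (R : Set (V × V)) : Set (V × V) := {x | (x.2, x.1) ∈ R}

/-- Relational composition (product of relations). -/
def comp (R S : Set (V × V)) : Set (V × V) := {x | ∃ w, (x.1, w) ∈ R ∧ (w, x.2) ∈ S}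

/-- The `n`-fold relational power, with `R^0` the diagonal. -/
def relPow (R : Set (V × V)) : ℕ → Set (V × V)
  | 0 => diag V
  | n + 1 => comp (relPow R n) R

/-- `⟨R⟩`, the union of all relational powers of `R`. -/
def gen (R : Set (V × V)) : Set (V × V) := ⋃ i, relPow R i

/-- Strong connectivity: every ordered pair is joined by a directed walk of positive length
(so every vertex has nonempty out-neighborhood). -/
def StronglyConnected (R : Set (V × V)) : Prop :=
  ∀ u v : V, ∃ n, 0 < n ∧ (u, v) ∈ relPow R n

/-- A digraph `(V, R)` is cyclically `p`-partite: the vertices are partitioned into `p`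
nonempty parts indexed by `ZMod p` such that every arc goes from part `r` to part `r + 1`. -/
def CyclicallyPartite (p : ℕ) (R : Set (V × V)) : Prop :=
  ∃ f : V → ZMod p, Surjective f ∧ ∀ u v : V, (u, v) ∈ R → f v = f u + 1

/-- The induced subdigraph on `X ⊆ V` is cyclically `p`-partite. -/
def CyclicallyPartiteOn (p : ℕ) (X : Set V) (R : Set (V × V)) : Prop :=
  ∃ f : V → ZMod p, (∀ r : ZMod p, ∃ v ∈ X, f v = r) ∧
    ∀ u ∈ X, ∀ v ∈ X, (u, v) ∈ R → f v = f u + 1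

/-- The out-neighborhood `R(u)`. -/
def neighb (R : Set (V × V)) (u : V) : Set V := {v | (u, v) ∈ R}

/-- A homogeneous coherent configuration (association scheme) on a finite set `V`. -/
structure AssocScheme (V : Type*) [Fintype V] where
  classes : Set (Set (V × V))
  part : ∀ x : V × V, ∃! R, R ∈ classes ∧ x ∈ R
  nonempty_mem : ∀ R ∈ classes, R.Nonempty
  transp_mem : ∀ R ∈ classes, transp R ∈ classes
  diag_mem : diag V ∈ classes
  inter : ∀ R ∈ classes, ∀ S ∈ classes, ∀ T ∈ classes, ∀ x ∈ T, ∀ y ∈ T,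
    ({w : V | (Prod.fst x, w) ∈ R ∧ (w, Prod.snd x) ∈ S}).ncard =
    ({w : V | (Prod.fst y, w) ∈ R ∧ (w, Prod.snd y) ∈ S}).ncard

/-- A `p`-scheme: every basis relation has cardinality a power of `p`. -/
def IsPScheme (p : ℕ) {V : Type*} [Fintype V] (C : AssocScheme V) : Prop :=
  ∀ R ∈ C.classes, ∃ k : ℕ, R.ncard = p ^ k

/-- A scheme equivalence: a union of basis relations that is an equivalence relation on `V`. -/
def IsSchemeEquiv {V : Type*} [Fintype V] (C : AssocScheme V) (E : Set (V × V)) : Prop :=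
  (∃ D ⊆ C.classes, E = ⋃₀ D) ∧ Equivalence (fun u v : V => (u, v) ∈ E)

/-- The set of classes of an equivalence relation `E` on `V`. -/
def classesOf {V : Type*} (E : Set (V × V)) : Set (Set V) :=
  {X | ∃ u : V, X = {v | (u, v) ∈ E}}

/-- The quotient relation `R_{V/E}` on the set of classes of `E`. -/
def quotRel {V : Type*} (E R : Set (V × V)) : Set (Set V × Set V) :=
  {q | q.1 ∈ classesOf E ∧ q.2 ∈ classesOf E ∧ (R ∩ q.1 ×ˢ q.2).Nonempty}

/-- A maximal scheme equivalence: `E ≠ V × V` and no scheme equivalence other than `V × V`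
properly contains it. -/
def MaximalEquiv {V : Type*} [Fintype V] (C : AssocScheme V) (E : Set (V × V)) : Prop :=
  IsSchemeEquiv C E ∧ E ≠ Set.univ ∧
    ∀ F, IsSchemeEquiv C F → E ⊆ F → F ≠ Set.univ → F = E

end Defs
namespace PS
open Classical in
noncomputable def ind {V : Type*} (S : Set (V × V)) : Matrix V V ℕ :=
  fun x y => if (x, y) ∈ S then 1 else 0

variable {V : Type*} [Fintype V]

def Const (C : AssocScheme V) (M : Matrix V V ℕ) : Prop :=
  ∀ R ∈ C.classes, ∀ x ∈ R, ∀ y ∈ R, M x.1 x.2 = M y.1 y.2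

noncomputable def cl (C : AssocScheme V) (x y : V) : Set (V × V) := (C.part (x, y)).choose

lemma cl_mem (C : AssocScheme V) (x y : V) : cl C x y ∈ C.classes :=
  (C.part (x, y)).choose_spec.1.1

lemma mem_cl (C : AssocScheme V) (x y : V) : (x, y) ∈ cl C x y :=
  (C.part (x, y)).choose_spec.1.2

lemma cl_eq (C : AssocScheme V) {x y : V} {R : Set (V × V)} (hR : R ∈ C.classes)
    (h : (x, y) ∈ R) : cl C x y = R :=
  ((C.part (x, y)).choose_spec.2 R ⟨hR, h⟩).symm

lemma cl_eq_iff (C : AssocScheme V) {x y : V} {R : Set (V × V)} (hR : R ∈ C.classes) :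
    cl C x y = R ↔ (x, y) ∈ R :=
  ⟨fun h => h ▸ mem_cl C x y, cl_eq C hR⟩

lemma Const.exists_fun {C : AssocScheme V} {M : Matrix V V ℕ} (h : Const C M) :
    ∃ f : Set (V × V) → ℕ, ∀ x y, M x y = f (cl C x y) := by
  classical
  refine ⟨fun R => if hR : R.Nonempty then M hR.some.1 hR.some.2 else 0, fun x y => ?_⟩
  have hne : (cl C x y).Nonempty := ⟨_, mem_cl C x y⟩
  simp only [hne, dif_pos]
  exact h _ (cl_mem C x y) (x, y) (mem_cl C x y) _ hne.some_mem

lemma Const.mul {C : AssocScheme V} {M N : Matrix V V ℕ} (hM : Const C M) (hN : Const C N) :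
    Const C (M * N) := by
  classical
  obtain ⟨f, hf⟩ := hM.exists_fun
  obtain ⟨g, hg⟩ := hN.exists_fun
  intro T hT x hx y hy
  have key : ∀ z : V × V, (M * N) z.1 z.2 = ∑ P : Set (V × V) × Set (V × V),
      ({w : V | (cl C z.1 w, cl C w z.2) = P}).ncard * (f P.1 * g P.2) := by
    intro z
    rw [Matrix.mul_apply]
    simp_rw [hf, hg]
    rw [← Finset.sum_fiberwise' Finset.univ (fun w => (cl C z.1 w, cl C w z.2))
      (fun P => f P.1 * g P.2)]
    refine Finset.sum_congr rfl fun P _ => ?_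
    rw [Finset.sum_const, smul_eq_mul, Set.ncard_eq_toFinset_card']
    congr 2
    ext w; simp
  rw [key, key]
  refine Finset.sum_congr rfl fun P _ => ?_
  congr 1
  by_cases h : P.1 ∈ C.classes ∧ P.2 ∈ C.classes
  · have := C.inter P.1 h.1 P.2 h.2 T hT x hx y hy
    simpa only [Prod.ext_iff, cl_eq_iff C h.1, cl_eq_iff C h.2] using this
  · have : ∀ z : V × V, {w : V | (cl C z.1 w, cl C w z.2) = P} = ∅ := by
      intro z
      ext w
      simp only [Set.mem_ofPred_eq, Set.mem_empty_iff_false, iff_false]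
      rintro rfl
      exact h ⟨cl_mem _ _ _, cl_mem _ _ _⟩
    rw [this, this]

/-- union of classes, pointwise form -/
def Inv (C : AssocScheme V) (S : Set (V × V)) : Prop :=
  ∀ R ∈ C.classes, ∀ x ∈ R, ∀ y ∈ R, x ∈ S → y ∈ S

lemma inv_of_class {C : AssocScheme V} {R : Set (V × V)} (hR : R ∈ C.classes) : Inv C R := by
  intro S hS x hx y hy h
  have h1 := cl_eq C (x := x.1) (y := x.2) hS hx
  have h2 := cl_eq C (x := x.1) (y := x.2) hR h
  rw [← h2, h1]; exact hy

lemma inv_of_equiv {C : AssocScheme V} {E : Set (V × V)} (hE : IsSchemeEquiv C E) : Inv C E := by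
  obtain ⟨⟨D, hD, rfl⟩, -⟩ := hE
  rintro R hR x hx y hy ⟨S, hS, hxS⟩
  exact ⟨S, hS, inv_of_class (hD hS) R hR x hx y hy hxS⟩

lemma equiv_of_inv {C : AssocScheme V} {E : Set (V × V)} (h : Inv C E)
    (h2 : Equivalence (fun u v : V => (u, v) ∈ E)) : IsSchemeEquiv C E := by
  refine ⟨⟨{R | R ∈ C.classes ∧ R ⊆ E}, fun R hR => hR.1, ?_⟩, h2⟩
  ext ⟨x, y⟩
  constructor
  · intro hx
    exact ⟨cl C x y, ⟨cl_mem C x y, fun z hz => h _ (cl_mem C x y) _ (mem_cl C x y) z hz hx⟩,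
      mem_cl C x y⟩
  · rintro ⟨R, ⟨-, hR⟩, hx⟩
    exact hR hx

lemma const_ind {C : AssocScheme V} {S : Set (V × V)} (h : Inv C S) : Const C (ind S) := by
  rintro R hR ⟨a, b⟩ hx ⟨c, d⟩ hy
  have : (a, b) ∈ S ↔ (c, d) ∈ S := ⟨h R hR _ hx _ hy, h R hR _ hy _ hx⟩
  by_cases hc : (c, d) ∈ S
  · simp only [ind, this, hc, if_true]
  · simp only [ind, this, hc, if_false]

lemma Const.row {C : AssocScheme V} {M : Matrix V V ℕ} (hM : Const C M) (x x' : V) :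
    ∑ y, M x y = ∑ y, M x' y := by
  have h1 : Const C (Matrix.of fun _ _ => 1 : Matrix V V ℕ) := fun _ _ _ _ _ _ => rfl
  have := (hM.mul h1) (diag V) C.diag_mem (x, x) rfl (x', x') rfl
  simpa [Matrix.mul_apply] using this

lemma sum_ind (S : Set (V × V)) (x : V) : ∑ y, ind S x y = (neighb S x).ncard := by
  classical
  simp only [ind, neighb, Set.ncard_eq_toFinset_card', Finset.sum_boole, Nat.cast_id]
  congr 1
  ext; simp

lemma neighb_card {C : AssocScheme V} {S : Set (V × V)} (h : Inv C S) (x x' : V) :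
    (neighb S x).ncard = (neighb S x').ncard := by
  rw [← sum_ind, ← sum_ind]; exact (const_ind h).row x x'

lemma exists_out {C : AssocScheme V} {R : Set (V × V)} (hR : R ∈ C.classes) (x : V) :
    ∃ y, (x, y) ∈ R := by
  obtain ⟨⟨a, b⟩, hab⟩ := C.nonempty_mem R hR
  have h1 : 0 < (neighb R a).ncard := (Set.ncard_pos).2 ⟨b, hab⟩
  rw [neighb_card (inv_of_class hR) a x] at h1
  exact (Set.ncard_pos).1 h1

lemma exists_in {C : AssocScheme V} {R : Set (V × V)} (hR : R ∈ C.classes) (y : V) :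
    ∃ x, (x, y) ∈ R := exists_out (C.transp_mem R hR) y

lemma exists_mid {C : AssocScheme V} {R : Set (V × V)} (hR : R ∈ C.classes)
    {x y z x' z' : V} (h : (x, z) ∈ R) (h' : (x', z') ∈ R) :
    ∃ y', (x', y') ∈ cl C x y ∧ (y', z') ∈ cl C y z := by
  have := C.inter _ (cl_mem C x y) _ (cl_mem C y z) R hR _ h _ h'
  have h1 : 0 < ({w : V | ((x,z).1, w) ∈ cl C x y ∧ (w, (x,z).2) ∈ cl C y z}).ncard :=
    (Set.ncard_pos).2 ⟨y, mem_cl C x y, mem_cl C y z⟩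
  rw [this] at h1
  exact (Set.ncard_pos).1 h1

/-- size of a relation restricted to a product `X × V` -/
lemma card_restrict {C : AssocScheme V} {R : Set (V × V)} (hR : Inv C R) (x0 : V) (X Y : Set V)
    (h : ∀ x ∈ X, ∀ y, (x, y) ∈ R → y ∈ Y) :
    (R ∩ X ×ˢ Y).ncard = X.ncard * (neighb R x0).ncard := by
  classical
  rw [Set.ncard_eq_toFinset_card' (R ∩ X ×ˢ Y),
    Finset.card_eq_sum_card_fiberwise (f := Prod.fst) (t := X.toFinset)]
  · rw [Set.ncard_eq_toFinset_card' X, ← smul_eq_mul, ← Finset.sum_const]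
    refine Finset.sum_congr rfl fun x hx => ?_
    rw [neighb_card hR x0 x, Set.ncard_eq_toFinset_card']
    refine Finset.card_bij (fun z _ => z.2) ?_ ?_ ?_
    · rintro ⟨a, b⟩ hz
      simp only [Finset.mem_filter, Set.mem_toFinset] at hz
      obtain ⟨hz, rfl⟩ := hz
      simp only [Set.mem_toFinset]
      exact hz.1
    · rintro ⟨a, b⟩ hz ⟨a', b'⟩ hz' hb
      simp only [Finset.mem_filter, Set.mem_toFinset] at hz hz'
      ext
      · exact hz.2.trans hz'.2.symm
      · exact hb
    · intro b hb
      simp only [Set.mem_toFinset] at hx hb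
      refine ⟨(x, b), ?_, rfl⟩
      simp only [Finset.mem_filter, Set.mem_toFinset, and_true]
      exact ⟨hb, hx, h x hx b hb⟩
  · rintro ⟨a, b⟩ hz
    simp at hz
    simpa using hz.2.1

def Blocks (p : ℕ) (C : AssocScheme V) : Prop :=
  ∀ E : Set (V × V), IsSchemeEquiv C E → ∀ X ∈ classesOf E, X ≠ Set.univ →
      ∀ R ∈ C.classes, (R ∩ X ×ˢ X).Nonempty → ∃ k : ℕ, (R ∩ X ×ˢ X).ncard = p ^ k

lemma neighb_ne {C : AssocScheme V} {E : Set (V × V)} (hE : IsSchemeEquiv C E)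
    (h : E ≠ Set.univ) (x : V) : neighb E x ≠ Set.univ := by
  intro hx
  apply h
  ext ⟨a, b⟩
  simp only [Set.mem_univ, iff_true]
  have ha : a ∈ neighb E x := hx ▸ Set.mem_univ a
  have hb : b ∈ neighb E x := hx ▸ Set.mem_univ b
  exact hE.2.trans (hE.2.symm ha) hb

lemma val_R {p : ℕ} (hp : p.Prime) {C : AssocScheme V} (hB : Blocks p C) {E : Set (V × V)}
    (hE : IsSchemeEquiv C E) (hne : E ≠ Set.univ) {R : Set (V × V)} (hR : R ∈ C.classes)
    (hRE : R ⊆ E) (x : V) :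
    ∃ k l : ℕ, (neighb E x).ncard = p ^ k ∧ (neighb R x).ncard = p ^ l := by
  obtain ⟨y, hy⟩ := exists_out hR x
  obtain ⟨k, hk⟩ := hB E hE (neighb E x) ⟨x, rfl⟩ (neighb_ne hE hne x) R hR
    ⟨(x, y), hy, hE.2.refl x, hRE hy⟩
  rw [card_restrict (inv_of_class hR) x] at hk
  · obtain ⟨a, -, ha⟩ := (Nat.dvd_prime_pow hp).1 (Dvd.intro _ hk)
    obtain ⟨b, -, hb⟩ := (Nat.dvd_prime_pow hp).1 (Dvd.intro_left _ hk)
    exact ⟨a, b, ha, hb⟩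
  · intro a ha b hab
    exact hE.2.trans ha (hRE hab)

lemma val_E {p : ℕ} (hp : p.Prime) {C : AssocScheme V} (hB : Blocks p C) {E : Set (V × V)}
    (hE : IsSchemeEquiv C E) (hne : E ≠ Set.univ) (x : V) :
    ∃ k : ℕ, (neighb E x).ncard = p ^ k := by
  obtain ⟨k, l, h, -⟩ := val_R hp hB hE hne C.diag_mem (R := diag V) (by
    rintro ⟨a, b⟩ (h : a = b)
    subst h
    exact hE.2.refl a) x
  exact ⟨k, h⟩


lemma row_mul {C : AssocScheme V} {M N : Matrix V V ℕ} (hN : Const C N) (x x0 : V) :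
    ∑ y, (M * N) x y = (∑ y, M x y) * ∑ y, N x0 y := by
  simp_rw [Matrix.mul_apply]
  rw [Finset.sum_comm, Finset.sum_mul]
  refine Finset.sum_congr rfl fun w _ => ?_
  rw [← Finset.mul_sum, hN.row w x0]

/-- `R` links the `D`-class of `x` with the `D`-class of `y`. -/
def Link (D R : Set (V × V)) (x y : V) : Prop := ∃ z w, (x, z) ∈ D ∧ (z, w) ∈ R ∧ (w, y) ∈ D

noncomputable def B (D R : Set (V × V)) : Matrix V V ℕ := ind D * ind R * ind D

lemma ind_ne_zero {S : Set (V × V)} {x y : V} : ind S x y ≠ 0 ↔ (x, y) ∈ S := by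
  classical
  simp [ind]

lemma B_ne_zero {D R : Set (V × V)} {x y : V} : B D R x y ≠ 0 ↔ Link D R x y := by
  classical
  simp only [B, Matrix.mul_apply, Link, ne_eq, Finset.sum_eq_zero_iff, not_forall, mul_eq_zero,
    not_or, Finset.mem_univ, true_imp_iff, ind_ne_zero]
  constructor
  · rintro ⟨w, ⟨z, h1, h2⟩, h3⟩
    exact ⟨z, w, h1, h2, h3⟩
  · rintro ⟨z, w, h1, h2, h3⟩
    exact ⟨w, ⟨z, h1, h2⟩, h3⟩

lemma B_const {C : AssocScheme V} {D R : Set (V × V)} (hD : Inv C D) (hR : Inv C R) :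
    Const C (B D R) := ((const_ind hD).mul (const_ind hR)).mul (const_ind hD)

lemma B_congr {C : AssocScheme V} {D R : Set (V × V)} (hD : IsSchemeEquiv C D) {x y z w : V}
    (h1 : (x, z) ∈ D) (h2 : (w, y) ∈ D) : B D R x y = B D R z w := by
  classical
  have e1 : ∀ a, ind D x a = ind D z a := by
    intro a
    have : (x, a) ∈ D ↔ (z, a) ∈ D := ⟨hD.2.trans (hD.2.symm h1), hD.2.trans h1⟩
    simp only [ind, this]
  have e2 : ∀ a, ind D a y = ind D a w := by
    intro a
    have : (a, y) ∈ D ↔ (a, w) ∈ D :=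
      ⟨fun h => hD.2.trans h (hD.2.symm h2), fun h => hD.2.trans h h2⟩
    simp only [ind, this]
  simp only [B, Matrix.mul_apply, e1, e2]

/-- valency of the double coset `DRD`. -/
lemma card_link {C : AssocScheme V} {D R : Set (V × V)} (hD : IsSchemeEquiv C D)
    (hR : R ∈ C.classes) {x0 y0 : V} (h0 : (x0, y0) ∈ R) (x : V) :
    B D R x0 y0 * ({y | Link D R x y}).ncard =
      (neighb D x0).ncard * (neighb R x0).ncard * (neighb D x0).ncard := by
  classical
  have hDi := inv_of_equiv hD
  have hRi := inv_of_class hR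
  have h1 : ∑ y, B D R x y =
      (neighb D x0).ncard * (neighb R x0).ncard * (neighb D x0).ncard := by
    rw [B, row_mul (const_ind hDi) x x0, row_mul (const_ind hRi) x x0, sum_ind, sum_ind, sum_ind,
      neighb_card hDi x x0]
  rw [← h1]
  have h2 : ∀ y, B D R x y = B D R x0 y0 * (if Link D R x y then 1 else 0) := by
    intro y
    split_ifs with h
    · obtain ⟨z, w, a, b, c⟩ := h
      rw [mul_one, B_congr hD a c]
      exact B_const hDi hRi R hR (z, w) b (x0, y0) h0
    · rw [mul_zero]
      by_contra hh
      exact h (B_ne_zero.1 hh)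
  rw [Finset.sum_congr rfl fun y _ => h2 y, ← Finset.mul_sum]
  congr 1
  rw [Finset.sum_boole, Set.ncard_eq_toFinset_card']
  simp only [Nat.cast_id]
  congr 1
  ext; simp

def Good (D R : Set (V × V)) : Prop :=
  ∀ x y x' y', (x, y) ∈ R → (x', y') ∈ R → ((x, x') ∈ D ↔ (y, y') ∈ D)

lemma good_of_half {C : AssocScheme V} {D R : Set (V × V)} (hD : IsSchemeEquiv C D)
    (hR : R ∈ C.classes)
    (h : ∀ x y x' y', (x, y) ∈ R → (x', y') ∈ R → (x, x') ∈ D → (y, y') ∈ D) : Good D R := by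
  let s : Setoid V := ⟨fun u v => (u, v) ∈ D, hD.2⟩
  choose o ho using fun x => exists_out hR x
  let f : Quotient s → Quotient s := Quotient.map o (fun a b hab => h _ _ _ _ (ho a) (ho b) hab)
  have hs : Function.Surjective f := by
    intro q
    induction q using Quotient.inductionOn with | h y => ?_
    obtain ⟨x, hx⟩ := exists_in hR y
    exact ⟨⟦x⟧, Quotient.sound (h _ _ _ _ (ho x) hx (hD.2.refl x))⟩
  have hi := Finite.injective_iff_surjective.2 hs
  intro x y x' y' hx hx'
  refine ⟨h x y x' y' hx hx', fun hy => ?_⟩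
  have : f ⟦x⟧ = f ⟦x'⟧ := Quotient.sound (hD.2.trans (h _ _ _ _ (ho x) hx (hD.2.refl x))
    (hD.2.trans hy (h _ _ _ _ hx' (ho x') (hD.2.refl x'))))
  exact Quotient.exact (hi this)

lemma exists_good {p : ℕ} (hp : p.Prime) {C : AssocScheme V} (hB : Blocks p C)
    {D E : Set (V × V)} (hD : IsSchemeEquiv C D) (hE : IsSchemeEquiv C E) (hDE : D ⊆ E)
    (hne : E ≠ Set.univ) (hED : ¬ E ⊆ D) :
    ∃ R ∈ C.classes, R ⊆ E ∧ ¬ R ⊆ D ∧ Good D R := by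
  classical
  have hDi := inv_of_equiv hD
  have hDne : D ≠ Set.univ := by rintro rfl; exact hED (Set.subset_univ _)
  obtain ⟨⟨x0, y1⟩, hE1, hD1⟩ := Set.not_subset.1 hED
  obtain ⟨d, hd⟩ := val_E hp hB hD hDne x0
  obtain ⟨e, he⟩ := val_E hp hB hE hne x0
  by_contra hcon
  push Not at hcon
  let φ : V → Set (Set (V × V)) := fun y => {R | R ∈ C.classes ∧ Link D R x0 y}
  have hself : ∀ y, Link D (cl C x0 y) x0 y :=
    fun y => ⟨x0, y, hD.2.refl _, mem_cl C x0 y, hD.2.refl _⟩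
  have hφ : ∀ y y', φ y' = φ y ↔ Link D (cl C x0 y) x0 y' := by
    intro y y'
    constructor
    · intro h
      have : cl C x0 y ∈ φ y' := h ▸ ⟨cl_mem C x0 y, hself y⟩
      exact this.2
    · rintro ⟨z, w, a, b, c⟩
      ext S
      refine and_congr_right fun hS => ?_
      rw [← B_ne_zero, ← B_ne_zero, B_congr hD a c,
        B_const hDi (inv_of_class hS) _ (cl_mem C x0 y) (z, w) b (x0, y) (mem_cl C x0 y)]
  have hsub : ∀ y ∈ neighb E x0, cl C x0 y ⊆ E := fun y hy z hz =>
    inv_of_equiv hE _ (cl_mem C x0 y) _ (mem_cl C x0 y) z hz hy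
  have hfib : ∀ y ∈ neighb E x0, y ∉ neighb D x0 →
      p ^ (d + 1) ∣ ({a ∈ (neighb E x0).toFinset | φ a = φ y}).card := by
    intro y hy hyD
    have hset : ({a ∈ (neighb E x0).toFinset | φ a = φ y}).card =
        ({a | Link D (cl C x0 y) x0 a}).ncard := by
      rw [Set.ncard_eq_toFinset_card']
      congr 1
      ext a
      simp only [Finset.mem_filter, Set.mem_toFinset, hφ, Set.mem_ofPred_eq, and_iff_right_iff_imp]
      rintro ⟨z, w, h1, h2, h3⟩
      exact hE.2.trans (hDE h1) (hE.2.trans (hsub y hy h2) (hDE h3))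
    rw [hset]
    set R := cl C x0 y with hRdef
    have hR : R ∈ C.classes := cl_mem C x0 y
    have hxy : (x0, y) ∈ R := mem_cl C x0 y
    have hcard := card_link hD hR hxy
    obtain ⟨k, l, -, hl⟩ := val_R hp hB hE hne hR (hsub y hy) x0
    rw [hl, hd, ← pow_add, ← pow_add] at hcard
    obtain ⟨m, -, hm⟩ := (Nat.dvd_prime_pow hp).1 (Dvd.intro_left _ (hcard x0))
    rw [hm]
    apply pow_dvd_pow
    by_contra hlt
    have hmd : m ≤ d := by omega
    apply hcon R hR (hsub y hy) (fun h => hyD (h hxy))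
    apply good_of_half hD hR
    intro a b a' b' hab hab' haa
    have hBpos : 0 < B D R x0 y := Nat.pos_of_ne_zero (B_ne_zero.2 (hself y))
    have hsz : ({c | Link D R a c}).ncard = p ^ m := by
      rw [← hm]
      exact Nat.eq_of_mul_eq_mul_left hBpos ((hcard a).trans (hcard x0).symm)
    have hss : neighb D b ⊆ {c | Link D R a c} := fun c hc => ⟨a, b, hD.2.refl _, hab, hc⟩
    have heq : neighb D b = {c | Link D R a c} := by
      apply Set.eq_of_subset_of_ncard_le hss
      rw [hsz, neighb_card hDi b x0, hd]
      exact Nat.pow_le_pow_right hp.pos hmd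
    have : b' ∈ {c | Link D R a c} := ⟨a', b', haa, hab', hD.2.refl _⟩
    rw [← heq] at this
    exact this
  have hlink0 : ∀ y, φ y = φ x0 ↔ (x0, y) ∈ D := by
    intro y
    rw [hφ, cl_eq C C.diag_mem (show (x0, x0) ∈ diag V from rfl)]
    constructor
    · rintro ⟨z, w, a, b, c⟩
      obtain rfl : z = w := b
      exact hD.2.trans a c
    · intro h
      exact ⟨x0, x0, hD.2.refl _, rfl, h⟩
  have hfib0 : ({a ∈ (neighb E x0).toFinset | φ a = φ x0}).card = p ^ d := by
    rw [← hd, Set.ncard_eq_toFinset_card']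
    congr 1
    ext a
    simp only [Finset.mem_filter, Set.mem_toFinset, hlink0]
    exact ⟨fun h => h.2, fun h => ⟨hDE h, h⟩⟩
  have htot := Finset.card_eq_sum_card_image φ (neighb E x0).toFinset
  have hx0 : φ x0 ∈ (neighb E x0).toFinset.image φ :=
    Finset.mem_image_of_mem _ (by simp only [Set.mem_toFinset]; exact hE.2.refl x0)
  rw [← Set.ncard_eq_toFinset_card', he, ← Finset.add_sum_erase _ _ hx0, hfib0] at htot
  have hdv : p ^ (d + 1) ∣ ∑ b ∈ ((neighb E x0).toFinset.image φ).erase (φ x0),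
      ({a ∈ (neighb E x0).toFinset | φ a = b}).card := by
    apply Finset.dvd_sum
    intro b hb
    obtain ⟨hb0, hb⟩ := Finset.mem_erase.1 hb
    obtain ⟨y, hy, rfl⟩ := Finset.mem_image.1 hb
    exact hfib y (by simpa using hy) (fun h => hb0 ((hlink0 y).2 h))
  have hlt : d < e := by
    have : (neighb D x0).ncard < (neighb E x0).ncard :=
      Set.ncard_lt_ncard ⟨fun a h => hDE h, fun h => hD1 (h hE1)⟩
    rw [hd, he] at this
    exact (Nat.pow_lt_pow_iff_right hp.one_lt).1 this
  have h3 : p ^ (d + 1) ∣ p ^ d := by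
    have := pow_dvd_pow p (show d + 1 ≤ e from hlt)
    rw [htot] at this
    exact (Nat.dvd_add_left hdv).1 this
  exact absurd ((Nat.pow_dvd_pow_iff_le_right hp.one_lt).1 h3) (by omega)

/-- union of the good classes -/
def T (C : AssocScheme V) (D : Set (V × V)) : Set (V × V) := {q | Good D (cl C q.1 q.2)}

lemma T_equiv (C : AssocScheme V) (D : Set (V × V)) :
    IsSchemeEquiv C (T C D) := by
  apply equiv_of_inv
  · rintro R hR ⟨a, b⟩ hx ⟨c, d⟩ hy h
    simp only [T, Set.mem_ofPred_eq, cl_eq C hR hx, cl_eq C hR hy] at h ⊢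
    exact h
  · refine ⟨?_, ?_, ?_⟩
    · intro x
      simp only [T, Set.mem_ofPred_eq, cl_eq C C.diag_mem (show (x, x) ∈ diag V from rfl)]
      rintro a b a' b' (rfl : a = b) (rfl : a' = b')
      rfl
    · intro x y h
      simp only [T, Set.mem_ofPred_eq] at h ⊢
      rw [cl_eq C (C.transp_mem _ (cl_mem C x y)) (show (y, x) ∈ transp _ from mem_cl C x y)]
      intro a b a' b' h1 h2
      exact (h b a b' a' h1 h2).symm
    · intro x y z h1 h2
      intro a c a' c' h3 h4
      obtain ⟨b, hb1, hb2⟩ := exists_mid (y := y) (cl_mem C x z) (mem_cl C x z) h3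
      obtain ⟨b', hb1', hb2'⟩ := exists_mid (y := y) (cl_mem C x z) (mem_cl C x z) h4
      exact (h1 a b a' b' hb1 hb1').trans (h2 b c b' c' hb2 hb2')

lemma D_sub_T {C : AssocScheme V} {D : Set (V × V)} (hD : IsSchemeEquiv C D) : D ⊆ T C D := by
  rintro ⟨x, y⟩ h a b a' b' h1 h2
  have h3 := inv_of_equiv hD _ (cl_mem C x y) _ (mem_cl C x y) _ h1 h
  have h4 := inv_of_equiv hD _ (cl_mem C x y) _ (mem_cl C x y) _ h2 h
  exact ⟨fun h => hD.2.trans (hD.2.symm h3) (hD.2.trans h h4),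
    fun h => hD.2.trans h3 (hD.2.trans h (hD.2.symm h4))⟩

lemma inter_equiv {C : AssocScheme V} {E F : Set (V × V)} (hE : IsSchemeEquiv C E)
    (hF : IsSchemeEquiv C F) : IsSchemeEquiv C (E ∩ F) := by
  apply equiv_of_inv
  · intro R hR x hx y hy h
    exact ⟨inv_of_equiv hE R hR x hx y hy h.1, inv_of_equiv hF R hR x hx y hy h.2⟩
  · exact ⟨fun x => ⟨hE.2.refl x, hF.2.refl x⟩, fun h => ⟨hE.2.symm h.1, hF.2.symm h.2⟩,
      fun h k => ⟨hE.2.trans h.1 k.1, hF.2.trans h.2 k.2⟩⟩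

/-- proper equivalences with improper join -/
def Pair (C : AssocScheme V) (P : Set (V × V) × Set (V × V)) : Prop :=
  IsSchemeEquiv C P.1 ∧ IsSchemeEquiv C P.2 ∧ P.1 ≠ Set.univ ∧ P.2 ≠ Set.univ ∧
    ∀ F, IsSchemeEquiv C F → P.1 ⊆ F → P.2 ⊆ F → F = Set.univ

lemma Pair.symm {C : AssocScheme V} {E F : Set (V × V)} (h : Pair C (E, F)) : Pair C (F, E) :=
  ⟨h.2.1, h.1, h.2.2.2.1, h.2.2.1, fun G hG h1 h2 => h.2.2.2.2 G hG h2 h1⟩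

lemma exists_pair {p : ℕ} (hp : p.Prime) {C : AssocScheme V} (hB : Blocks p C)
    (h : ∃ P, Pair C P) : ∃ E F, Pair C (E, F) ∧ T C (E ∩ F) = Set.univ := by
  classical
  obtain ⟨⟨E, F⟩, hP, hmax⟩ := Finset.exists_max_image
    (Finset.univ.filter fun P => Pair C P) (fun P => (P.1 ∩ P.2).ncard)
    (by obtain ⟨P, hP⟩ := h; exact ⟨P, by simpa using hP⟩)
  simp only [Finset.mem_filter, Finset.mem_univ, true_and] at hP hmax
  refine ⟨E, F, hP, ?_⟩
  by_contra hT
  have hD := inter_equiv hP.1 hP.2.1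
  have hTe := T_equiv C (E ∩ F)
  have key : ∀ X, IsSchemeEquiv C X → X ≠ Set.univ → E ∩ F ⊆ X → ¬ X ⊆ E ∩ F →
      ∃ z ∈ X, z ∈ T C (E ∩ F) ∧ z ∉ E ∩ F := by
    intro X hX hXne h1 h2
    obtain ⟨R, hR, hRX, hRD, hg⟩ := exists_good hp hB hD hX h1 hXne h2
    obtain ⟨⟨a, b⟩, hz, hzD⟩ := Set.not_subset.1 hRD
    refine ⟨(a, b), hRX hz, ?_, hzD⟩
    simp only [T, Set.mem_ofPred_eq, cl_eq C hR hz]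
    exact hg
  have hDT := D_sub_T hD
  have bad : ∀ X Y, Pair C (X, Y) → E ∩ F ⊆ X ∩ Y → (∃ z ∈ X ∩ Y, z ∉ E ∩ F) → False := by
    rintro X Y hXY h1 ⟨z, hz, hz2⟩
    have h3 := hmax (X, Y) hXY
    have : (E ∩ F).ncard < (X ∩ Y).ncard := Set.ncard_lt_ncard ⟨h1, fun h => hz2 (h hz)⟩
    simp only at h3
    omega
  have hEF : ¬ E ⊆ F := fun h => hP.2.2.2.1 (hP.2.2.2.2 F hP.2.1 h subset_rfl)
  have hFE : ¬ F ⊆ E := fun h => hP.2.2.1 (hP.2.2.2.2 E hP.1 subset_rfl h)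
  by_cases hj : ∃ G, IsSchemeEquiv C G ∧ G ≠ Set.univ ∧ E ⊆ G ∧ T C (E ∩ F) ⊆ G
  · obtain ⟨G, hG, hGne, hEG, hTG⟩ := hj
    obtain ⟨z, hz, hzT, hzD⟩ := key F hP.2.1 hP.2.2.2.1 Set.inter_subset_right
      (fun h => hFE (h.trans Set.inter_subset_left))
    exact bad G F ⟨hG, hP.2.1, hGne, hP.2.2.2.1,
      fun K hK h1 h2 => hP.2.2.2.2 K hK (hEG.trans h1) h2⟩
      (Set.inter_subset_inter_left _ hEG) ⟨z, ⟨hTG hzT, hz⟩, hzD⟩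
  · push Not at hj
    obtain ⟨z, hz, hzT, hzD⟩ := key E hP.1 hP.2.2.1 Set.inter_subset_left
      (fun h => hEF (h.trans Set.inter_subset_right))
    refine bad E (T C (E ∩ F)) ⟨hP.1, hTe, hP.2.2.1, hT, fun K hK h1 h2 => ?_⟩
      (Set.subset_inter Set.inter_subset_left hDT) ⟨z, ⟨hz, hzT⟩, hzD⟩
    by_contra hK2
    exact hj K hK hK2 h1 h2

/-- A thin quotient, encoded as a group-valued cocycle. -/
structure Cocycle (C : AssocScheme V) (D : Set (V × V)) (G : Type*) [Group G] where
  δ : V → V → G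
  mul : ∀ x y z, δ x z = δ y z * δ x y
  surj : ∀ x g, ∃ y, δ x y = g
  one_iff : ∀ x y, δ x y = 1 ↔ (x, y) ∈ D
  const : ∀ R ∈ C.classes, ∀ x ∈ R, ∀ y ∈ R, δ x.1 x.2 = δ y.1 y.2

namespace Cocycle
variable {C : AssocScheme V} {D : Set (V × V)} {G : Type*} [Group G]

lemma self (c : Cocycle C D G) (x : V) : c.δ x x = 1 := by
  have := c.mul x x x
  exact left_eq_mul.1 this

lemma inv (c : Cocycle C D G) (x y : V) : c.δ y x = (c.δ x y)⁻¹ := by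
  have := c.mul x y x
  rw [c.self] at this
  exact eq_inv_of_mul_eq_one_left this.symm

def eqv (c : Cocycle C D G) (H : Subgroup G) : Set (V × V) := {q | c.δ q.1 q.2 ∈ H}

lemma eqv_equiv (c : Cocycle C D G) (H : Subgroup G) : IsSchemeEquiv C (c.eqv H) := by
  apply equiv_of_inv
  · intro R hR x hx y hy h
    simp only [eqv, Set.mem_ofPred_eq] at h ⊢
    rwa [← c.const R hR x hx y hy]
  · refine ⟨fun x => ?_, fun {x y} h => ?_, fun {x y z} h1 h2 => ?_⟩
    · simp only [eqv, Set.mem_ofPred_eq, c.self]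
      exact H.one_mem
    · simp only [eqv, Set.mem_ofPred_eq] at h ⊢
      rw [c.inv]; exact H.inv_mem h
    · simp only [eqv, Set.mem_ofPred_eq] at h1 h2 ⊢
      rw [c.mul x y z]; exact H.mul_mem h2 h1

lemma eqv_ne (c : Cocycle C D G) {H : Subgroup G} (hH : H ≠ ⊤) (x : V) : c.eqv H ≠ Set.univ := by
  intro h
  apply hH
  rw [Subgroup.eq_top_iff']
  intro g
  obtain ⟨y, rfl⟩ := c.surj x g
  have : (x, y) ∈ c.eqv H := h ▸ Set.mem_univ _
  exact this

lemma card_eqv [Finite G] (c : Cocycle C D G) (hD : Inv C D) (H : Subgroup G) (x : V) :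
    (neighb (c.eqv H) x).ncard = Nat.card H * (neighb D x).ncard := by
  classical
  have := Fintype.ofFinite G
  rw [Set.ncard_eq_toFinset_card', Finset.card_eq_sum_card_fiberwise (f := c.δ x)
    (t := (H : Set G).toFinset)]
  · have : Nat.card H = (H : Set G).toFinset.card := by
      rw [← Set.ncard_eq_toFinset_card']; rfl
    rw [this, ← smul_eq_mul, ← Finset.sum_const]
    refine Finset.sum_congr rfl fun g hg => ?_
    obtain ⟨w, rfl⟩ := c.surj x g
    rw [neighb_card hD x w, Set.ncard_eq_toFinset_card']
    congr 1
    ext y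
    have hg' : c.δ x w ∈ H := by simpa using hg
    simp only [Finset.mem_filter, Set.mem_toFinset]
    change c.δ x y ∈ H ∧ _ ↔ (w, y) ∈ D
    rw [← c.one_iff, c.mul x w y, mul_eq_right]
    refine ⟨fun h => h.2, fun h => ⟨?_, h⟩⟩
    rw [h, one_mul]; exact hg'
  · intro y hy
    simp only [Set.coe_toFinset] at hy ⊢
    exact hy

/-- subgroup of an equivalence containing `D` -/
def sub (c : Cocycle C D G) (E : Set (V × V)) (hE : IsSchemeEquiv C E)
    (hDE : D ⊆ E) : Subgroup G where
  carrier := {g | ∀ x y, c.δ x y = g → (x, y) ∈ E}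
  one_mem' := by
    intro x y h
    exact hDE ((c.one_iff x y).1 h)
  mul_mem' := by
    intro a b ha hb x z h
    obtain ⟨y, hy⟩ := c.surj x b
    refine hE.2.trans (hb x y hy) (ha y z ?_)
    rw [c.mul x y z, hy] at h
    exact mul_right_cancel h
  inv_mem' := by
    intro a ha x y h
    refine hE.2.symm (ha y x ?_)
    rw [c.inv, h, inv_inv]

lemma eqv_sub (c : Cocycle C D G) (E : Set (V × V)) (hE : IsSchemeEquiv C E) (hDE : D ⊆ E) :
    c.eqv (c.sub E hE hDE) = E := by
  ext ⟨x, y⟩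
  constructor
  · intro h
    exact h x y rfl
  · intro h x' y' h'
    obtain ⟨y'', hy⟩ := exists_out (cl_mem C x y) x'
    have h1 : (x', y'') ∈ E := inv_of_equiv hE _ (cl_mem C x y) _ (mem_cl C x y) _ hy h
    have h2 := c.const _ (cl_mem C x y) _ (mem_cl C x y) _ hy
    simp only at h2 h'
    refine hE.2.trans h1 (hDE ((c.one_iff _ _).1 ?_))
    rw [← h', c.mul x' y'' y'] at h2
    exact mul_eq_right.1 h2

end Cocycle

lemma cyclic_le {G : Type*} [Group G] [Finite G] [IsCyclic G] {H K : Subgroup G}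
    (h : Nat.card H ∣ Nat.card K) : H ≤ K := by
  classical
  have := Fintype.ofFinite G
  have h1 := IsCyclic.card_pow_eq_one_le (α := G) (n := Nat.card K) Nat.card_pos
  have hsub : (K : Set G).toFinset ⊆ Finset.univ.filter fun a : G => a ^ Nat.card K = 1 := by
    intro a ha
    have ha' : a ∈ K := by simpa using ha
    simp only [Finset.mem_filter, Finset.mem_univ, true_and]
    exact orderOf_dvd_iff_pow_eq_one.1 (Subgroup.orderOf_dvd_natCard K ha')
  have hc : (K : Set G).toFinset.card = Nat.card K := by
    rw [← Set.ncard_eq_toFinset_card']; rfl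
  have heq := Finset.eq_of_subset_of_card_le hsub (by rw [hc]; exact h1)
  intro a ha
  have : a ∈ (K : Set G).toFinset := by
    rw [heq]
    simp only [Finset.mem_filter, Finset.mem_univ, true_and]
    exact orderOf_dvd_iff_pow_eq_one.1 ((Subgroup.orderOf_dvd_natCard H ha).trans h)
  simpa using this


lemma finish {p : ℕ} (hp : p.Prime) {C : AssocScheme V} (hB : Blocks p C) {E F : Set (V × V)}
    (hP : Pair C (E, F)) {G : Type*} [Group G] [Finite G] (c : Cocycle C (E ∩ F) G) :
    IsPScheme p C := by
  classical
  have hE : IsSchemeEquiv C E := hP.1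
  have hF : IsSchemeEquiv C F := hP.2.1
  have hEF : ¬ E ⊆ F := fun h => hP.2.2.2.1 (hP.2.2.2.2 F hP.2.1 h subset_rfl)
  have hFE : ¬ F ⊆ E := fun h => hP.2.2.1 (hP.2.2.2.2 E hP.1 subset_rfl h)
  have hD := inter_equiv hE hF
  have hDi := inv_of_equiv hD
  obtain ⟨⟨x0, -⟩, -⟩ := C.nonempty_mem _ C.diag_mem
  have hcard : ∀ H : Subgroup G, H ≠ ⊤ → ∃ k, Nat.card H = p ^ k := by
    intro H hH
    obtain ⟨k, hk⟩ := val_E hp hB (c.eqv_equiv H) (c.eqv_ne hH x0) x0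
    rw [c.card_eqv hDi] at hk
    obtain ⟨a, -, ha⟩ := (Nat.dvd_prime_pow hp).1 (Dvd.intro _ hk)
    exact ⟨a, ha⟩
  have hsub : ∀ {H K : Subgroup G}, H ≤ K → c.eqv H ⊆ c.eqv K := fun h q hq => h hq
  have hcyc : ∀ g : G, Subgroup.zpowers g ≠ ⊤ := by
    intro g hg
    have : IsCyclic G := ⟨g, fun x => by
      have : x ∈ (⊤ : Subgroup G) := Subgroup.mem_top x
      rwa [← hg] at this⟩
    have e1 := c.eqv_sub E hE Set.inter_subset_left
    have e2 := c.eqv_sub F hF Set.inter_subset_right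
    set H := c.sub E hE Set.inter_subset_left
    set K := c.sub F hF Set.inter_subset_right
    have htop : c.eqv ⊤ = Set.univ := by ext q; simp [Cocycle.eqv]
    obtain ⟨a, ha⟩ := hcard H (fun h => hP.2.2.1 (by rw [← e1, h, htop]))
    obtain ⟨b, hb⟩ := hcard K (fun h => hP.2.2.2.1 (by rw [← e2, h, htop]))
    rcases le_total a b with hab | hab
    · apply hEF
      have h := hsub (cyclic_le (H := H) (K := K) (by rw [ha, hb]; exact pow_dvd_pow p hab))
      rwa [e1, e2] at h
    · apply hFE
      have h := hsub (cyclic_le (H := K) (K := H) (by rw [ha, hb]; exact pow_dvd_pow p hab))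
      rwa [e2, e1] at h
  have : Fact p.Prime := ⟨hp⟩
  have hG : ∃ n, Nat.card G = p ^ n := by
    rw [← IsPGroup.iff_card, IsPGroup.iff_orderOf]
    intro g
    obtain ⟨k, hk⟩ := hcard _ (hcyc g)
    exact ⟨k, by rw [← hk, Nat.card_zpowers]⟩
  obtain ⟨n, hn⟩ := hG
  have hDne : E ∩ F ≠ Set.univ := fun h => hP.2.2.1 (by
    rw [Set.eq_univ_iff_forall] at h ⊢
    exact fun x => (h x).1)
  obtain ⟨d, hd⟩ := val_E hp hB hD hDne x0
  have hV : (Set.univ : Set V).ncard = p ^ (n + d) := by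
    have h1 := c.card_eqv hDi ⊤ x0
    have h2 : neighb (c.eqv ⊤) x0 = Set.univ := by ext q; simp [Cocycle.eqv, neighb]
    rw [h2, Subgroup.card_top, hn, hd, ← pow_add] at h1
    exact h1
  intro R hR
  obtain ⟨y, hy⟩ := exists_out hR x0
  have hRs : R ⊆ c.eqv (Subgroup.zpowers (c.δ x0 y)) := by
    intro z hz
    have := c.const R hR (x0, y) hy z hz
    simp only [Cocycle.eqv, Set.mem_ofPred_eq, ← this]
    exact Subgroup.mem_zpowers _
  obtain ⟨k, l, -, hl⟩ := val_R hp hB (c.eqv_equiv _) (c.eqv_ne (hcyc (c.δ x0 y)) x0) hR hRs x0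
  have := card_restrict (inv_of_class hR) x0 Set.univ Set.univ (fun _ _ _ _ => Set.mem_univ _)
  rw [Set.univ_prod_univ, Set.inter_univ, hV, hl, ← pow_add] at this
  exact ⟨_, this⟩

/-- the setoid of a scheme equivalence -/
def sd {C : AssocScheme V} {D : Set (V × V)} (hD : IsSchemeEquiv C D) : Setoid V :=
  ⟨fun u v => (u, v) ∈ D, hD.2⟩

def mk {C : AssocScheme V} {D : Set (V × V)} (hD : IsSchemeEquiv C D) (x : V) :
    Quotient (sd hD) := Quotient.mk _ x

lemma mk_eq {C : AssocScheme V} {D : Set (V × V)} (hD : IsSchemeEquiv C D) {x y : V} :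
    mk hD x = mk hD y ↔ (x, y) ∈ D :=
  ⟨fun h => Quotient.exact h, fun h => Quotient.sound h⟩

def Ind {C : AssocScheme V} {D : Set (V × V)} (hD : IsSchemeEquiv C D)
    (R : Set (V × V)) (σ : Equiv.Perm (Quotient (sd hD))) : Prop :=
  ∀ x y, (x, y) ∈ R → σ (mk hD x) = mk hD y

lemma exists_ind {C : AssocScheme V} {D : Set (V × V)} (hD : IsSchemeEquiv C D)
    {R : Set (V × V)} (hR : R ∈ C.classes) (hg : Good D R) : ∃ σ, Ind hD R σ := by
  choose o ho using fun x => exists_out hR x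
  let f : Quotient (sd hD) → Quotient (sd hD) :=
    Quotient.map o (fun a b hab => (hg _ _ _ _ (ho a) (ho b)).1 hab)
  have hi : Function.Injective f := by
    intro q q' h
    induction q using Quotient.inductionOn with | h x => ?_
    induction q' using Quotient.inductionOn with | h y => ?_
    exact Quotient.sound ((hg _ _ _ _ (ho x) (ho y)).2 (Quotient.exact h))
  refine ⟨Equiv.ofBijective f ⟨hi, Finite.injective_iff_surjective.1 hi⟩, fun x y hxy => ?_⟩
  exact Quotient.sound ((hg _ _ _ _ (ho x) hxy).1 (hD.2.refl x))

def grp {C : AssocScheme V} {D : Set (V × V)} (hD : IsSchemeEquiv C D) :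
    Subgroup (Equiv.Perm (Quotient (sd hD))) where
  carrier := {σ | ∃ R ∈ C.classes, Ind hD R σ}
  one_mem' := ⟨diag V, C.diag_mem, by rintro x y (rfl : x = y); rfl⟩
  mul_mem' := by
    rintro σ τ ⟨R, hR, h1⟩ ⟨S, hS, h2⟩
    obtain ⟨⟨x, y⟩, hxy⟩ := C.nonempty_mem S hS
    obtain ⟨z, hz⟩ := exists_out hR y
    refine ⟨cl C x z, cl_mem C x z, fun x' z' h => ?_⟩
    obtain ⟨y', h3, h4⟩ := exists_mid (y := y) (cl_mem C x z) (mem_cl C x z) h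
    rw [cl_eq C hS hxy] at h3
    rw [cl_eq C hR hz] at h4
    rw [Equiv.Perm.mul_apply, h2 _ _ h3, h1 _ _ h4]
  inv_mem' := by
    rintro σ ⟨R, hR, h1⟩
    refine ⟨transp R, C.transp_mem R hR, fun x y h => ?_⟩
    rw [Equiv.Perm.inv_eq_iff_eq]
    exact (h1 y x h).symm

lemma grp_one {C : AssocScheme V} {D : Set (V × V)} (hD : IsSchemeEquiv C D)
    (σ : grp hD) {x : V} (h : σ.1 (mk hD x) = mk hD x) : σ = 1 := by
  obtain ⟨σ, R, hR, hσ⟩ := σ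
  apply Subtype.ext
  ext q
  induction q using Quotient.inductionOn with | h x' => ?_
  obtain ⟨y, hy⟩ := exists_out hR x
  obtain ⟨y', hy'⟩ := exists_out hR x'
  have h1 : (x, y) ∈ D := (mk_eq hD).1 (h.symm.trans (hσ x y hy))
  have h2 : (x', y') ∈ D := inv_of_equiv hD R hR _ hy _ hy' h1
  exact (hσ x' y' hy').trans ((mk_eq hD).2 h2).symm

lemma grp_ext {C : AssocScheme V} {D : Set (V × V)} (hD : IsSchemeEquiv C D)
    (σ τ : grp hD) {x : V} (h : σ.1 (mk hD x) = τ.1 (mk hD x)) : σ = τ := by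
  have : τ⁻¹ * σ = 1 := grp_one hD _ (x := x) (by
    change τ.1⁻¹ (σ.1 (mk hD x)) = _
    rw [h, Equiv.Perm.inv_eq_iff_eq])
  exact (inv_mul_eq_one.1 this).symm

lemma exists_cocycle {C : AssocScheme V} {D : Set (V × V)} (hD : IsSchemeEquiv C D)
    (hT : T C D = Set.univ) : Nonempty (Cocycle C D (grp hD)) := by
  have hg : ∀ x y, Good D (cl C x y) := fun x y => by
    have : (x, y) ∈ T C D := hT ▸ Set.mem_univ _
    exact this
  choose σ hσ using fun x y => exists_ind hD (cl_mem C x y) (hg x y)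
  let δ : V → V → grp hD := fun x y => ⟨σ x y, cl C x y, cl_mem C x y, hσ x y⟩
  have hδ : ∀ x y, (δ x y).1 (mk hD x) = mk hD y := fun x y => hσ x y x y (mem_cl C x y)
  refine ⟨⟨δ, ?_, ?_, ?_, ?_⟩⟩
  · intro x y z
    apply grp_ext hD (x := x)
    change _ = (δ y z).1 ((δ x y).1 (mk hD x))
    rw [hδ, hδ, hδ]
  · intro x g
    obtain ⟨y, hy⟩ := Quotient.exists_rep (g.1 (mk hD x))
    exact ⟨y, grp_ext hD (x := x) _ _ ((hδ x y).trans hy)⟩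
  · intro x y
    rw [← mk_eq hD]
    constructor
    · intro h
      have := hδ x y
      rw [h] at this
      exact this
    · intro h
      exact grp_one hD (x := x) _ ((hδ x y).trans h.symm)
  · rintro R hR ⟨x, y⟩ hx ⟨x', y'⟩ hy
    apply grp_ext hD (x := x')
    change _ = (δ x' y').1 (mk hD x')
    rw [hδ]
    refine hσ x y x' y' ?_
    rw [cl_eq C hR hx]
    exact hy

end PS

/-- if `C` has at least two distinct maximal scheme equivalences and every
restriction to a nontrivial block is a `p`-scheme, then `C` is a `p`-scheme. -/
theorem pScheme_of_blocks {V : Type*} [Fintype V] {p : ℕ} (hp : p.Prime)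
    (C : AssocScheme V)
    (hmax : ∃ E₁ E₂ : Set (V × V), E₁ ≠ E₂ ∧ MaximalEquiv C E₁ ∧ MaximalEquiv C E₂)
    (hblocks : ∀ E : Set (V × V), IsSchemeEquiv C E → ∀ X ∈ classesOf E, X ≠ Set.univ →
      ∀ R ∈ C.classes, (R ∩ X ×ˢ X).Nonempty → ∃ k : ℕ, (R ∩ X ×ˢ X).ncard = p ^ k) :
    IsPScheme p C := by 
  obtain ⟨E₁, E₂, hne, h1, h2⟩ := hmax
  have hP : PS.Pair C (E₁, E₂) := by
    refine ⟨h1.1, h2.1, h1.2.1, h2.2.1, fun F hF h3 h4 => ?_⟩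
    by_contra hF2
    exact hne ((h1.2.2 F hF h3 hF2).symm.trans (h2.2.2 F hF h4 hF2))
  obtain ⟨E, F, hEF, hT⟩ := PS.exists_pair hp hblocks ⟨_, hP⟩
  obtain ⟨c⟩ := PS.exists_cocycle (PS.inter_equiv hEF.1 hEF.2.1) hT
  exact PS.finish hp hblocks hEF c
end

section
/- Let p be a prime and C an association scheme. Then C is a p-scheme if and only if every non-reflexive basis digraph of C is cyclically p-partite. -/
open Set Function

namespace PSch

set_option linter.unusedSectionVars false

open scoped Classical

/-- Abstract colouring form of an association scheme. -/
structure IsSch {V K : Type*} (r : V → V → K) : Prop where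
  dg : ∀ u v w, r u u = r v w ↔ v = w
  sy : ∀ u v u' v', r u v = r u' v' → r v u = r v' u'
  tri : ∀ u v u' v', r u v = r u' v' →
    ∃ e : V ≃ V, ∀ w, r u' (e w) = r u w ∧ r (e w) v' = r w v

/-- A function constant on the colour classes. -/
def Coh {V K α : Type*} (r : V → V → K) (M : V → V → α) : Prop :=
  ∀ u v u' v', r u v = r u' v' → M u v = M u' v'

section A

variable {V K : Type*} {r : V → V → K}

lemma IsSch.dg' (h : IsSch r) (u v : V) : r u u = r v v := (h.dg u v v).2 rfl

lemma IsSch.ex (h : IsSch r) {u v u' v' : V} (he : r u v = r u' v') (w : V) :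
    ∃ w', r u' w' = r u w ∧ r w' v' = r w v := by
  obtain ⟨e, he⟩ := h.tri _ _ _ _ he
  exact ⟨e w, he w⟩

/-- out-neighbours of every colour exist -/
lemma IsSch.out (h : IsSch r) (u v a : V) : ∃ b, r a b = r u v := by
  obtain ⟨w, hw, -⟩ := h.ex (h.dg' u a) v
  exact ⟨w, hw⟩

lemma IsSch.inn (h : IsSch r) (u v b : V) : ∃ a, r a b = r u v := by
  obtain ⟨a, ha⟩ := h.out v u b
  exact ⟨a, h.sy _ _ _ _ ha⟩

lemma Coh.iff {P : V → V → Prop} (hP : Coh r P) {u v u' v' : V} (he : r u v = r u' v') :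
    P u v ↔ P u' v' := by rw [hP _ _ _ _ he]

lemma coh_class (c : K) : Coh r (fun u v => r u v = c) := by
  intro u v u' v' he
  simp only [he]

lemma coh_eq (h : IsSch r) : Coh r (fun u v => u = v) := by
  intro u v u' v' he
  change (u = v) = (u' = v')
  rw [← h.dg u u v, ← h.dg u u' v', he]

lemma coh_comp (h : IsSch r) {P Q : V → V → Prop} (hP : Coh r P) (hQ : Coh r Q) :
    Coh r (fun u v => ∃ w, P u w ∧ Q w v) := by
  have key : ∀ u v u' v', r u v = r u' v' → (∃ w, P u w ∧ Q w v) → ∃ w, P u' w ∧ Q w v' := by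
    rintro u v u' v' he ⟨w, h1, h2⟩
    obtain ⟨w', h3, h4⟩ := h.ex he w
    exact ⟨w', (hP.iff h3).2 h1, (hQ.iff h4).2 h2⟩
  intro u v u' v' he
  exact propext ⟨key _ _ _ _ he, key _ _ _ _ he.symm⟩

lemma coh_sum [Fintype V] (h : IsSch r) {M N : V → V → ℕ} (hM : Coh r M) (hN : Coh r N) :
    Coh r (fun u v => ∑ w, M u w * N w v) := by
  intro u v u' v' he
  obtain ⟨e, he⟩ := h.tri _ _ _ _ he
  refine Fintype.sum_equiv e _ _ fun w => ?_
  rw [hM _ _ _ _ (he w).1, hN _ _ _ _ (he w).2]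

lemma coh_card [Fintype V] (h : IsSch r) {P Q : V → V → Prop} (hP : Coh r P) (hQ : Coh r Q) :
    Coh r (fun u v => (Finset.univ.filter fun w => P u w ∧ Q w v).card) := by
  intro u v u' v' he
  obtain ⟨e, he⟩ := h.tri _ _ _ _ he
  refine Finset.card_equiv e fun w => ?_
  simp only [Finset.mem_filter, Finset.mem_univ, true_and]
  rw [hP.iff (he w).1, hQ.iff (he w).2]

lemma deg_const [Fintype V] (h : IsSch r) {P : V → V → Prop} (hP : Coh r P) (u v : V) :
    (Finset.univ.filter fun w => P u w).card = (Finset.univ.filter fun w => P v w).card := by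
  obtain ⟨e, he⟩ := h.tri _ _ _ _ (h.dg' u v)
  refine Finset.card_equiv e fun w => ?_
  simp only [Finset.mem_filter, Finset.mem_univ, true_and]
  rw [hP.iff (he w).1]

/-- a coherent preorder on a finite set is symmetric -/
lemma coh_symm [Fintype V] (h : IsSch r) {P : V → V → Prop} (hP : Coh r P)
    (ht : ∀ u v w, P u v → P v w → P u w) (hr : ∀ u, P u u) (u v : V) (huv : P u v) : P v u := by
  have hsub : (Finset.univ.filter fun w => P v w) ⊆ (Finset.univ.filter fun w => P u w) := by
    intro w hw
    simp only [Finset.mem_filter, Finset.mem_univ, true_and] at hw ⊢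
    exact ht _ _ _ huv hw
  have := Finset.eq_of_subset_of_card_le hsub (deg_const h hP u v).le
  have hu : u ∈ (Finset.univ.filter fun w => P u w) := by simp [hr]
  rw [← this] at hu
  simpa using hu

/-- `R` is thin over `E` at `(u,v)`. -/
def Thin (r : V → V → K) (E : Setoid V) (u v : V) : Prop :=
  ∀ u' v', E u u' → r u' v' = r u v → E v v'

lemma coh_thin (h : IsSch r) {E : Setoid V} (hE : Coh r (fun u v => E u v)) :
    Coh r (Thin r E) := by
  have hn : Coh r (fun u v => ¬ E u v) := by
    intro u v u' v' he
    simp only [hE.iff he]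
  have key : ∀ u v u' v', r u v = r u' v' → Thin r E u v → Thin r E u' v' := by
    intro u v u' v' he ht a b ha hb
    by_contra hcon
    have h2 := coh_comp h hE (coh_comp h (coh_class (r u v)) hn)
    have h3 := (h2.iff he).2 ⟨a, ha, b, hb.trans he.symm, fun hh => hcon (E.symm hh)⟩
    obtain ⟨a', ha', b', hb', hab⟩ := h3
    exact hab (E.symm (ht a' b' ha' hb'))
  intro u v u' v' he
  exact propext ⟨key _ _ _ _ he, key _ _ _ _ he.symm⟩

/-- A thin colour induces a permutation of the blocks. -/
lemma thin_perm [Fintype V] (h : IsSch r) {E : Setoid V} (hE : Coh r (fun u v => E u v))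
    {u v : V} (ht : Thin r E u v) :
    ∃ σ : Equiv.Perm (Quotient E), ∀ a b, r a b = r u v →
      σ (Quotient.mk E a) = Quotient.mk E b := by
  choose g hg using fun a => h.out u v a
  have hT : ∀ a b, r a b = r u v → Thin r E a b := fun a b hab => ((coh_thin h hE).iff hab).2 ht
  let f : Quotient E → Quotient E := Quotient.lift (fun a => Quotient.mk E (g a)) (by
    intro a b hab
    exact Quotient.sound (hT a (g a) (hg a) b (g b) hab ((hg b).trans (hg a).symm)))
  have hf : ∀ a b, r a b = r u v → f (Quotient.mk E a) = Quotient.mk E b := by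
    intro a b hab
    exact Quotient.sound (hT a (g a) (hg a) a b (E.refl a) (hab.trans (hg a).symm))
  have hs : Surjective f := by
    intro x
    obtain ⟨b, rfl⟩ := Quotient.exists_rep x
    obtain ⟨a, ha⟩ := h.inn u v b
    exact ⟨_, hf a b ha⟩
  have hb : Bijective f := ⟨Finite.injective_iff_surjective.2 hs, hs⟩
  exact ⟨Equiv.ofBijective f hb, hf⟩

/-- The thin radical of `D` over `E`. -/
def thinSetoid [Fintype V] (h : IsSch r) {E D : Setoid V} (hE : Coh r (fun u v => E u v)) :
    Setoid V where
  r u v := D u v ∧ Thin r E u v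
  iseqv := by
    refine ⟨fun u => ⟨D.refl u, ?_⟩, ?_, ?_⟩
    · intro a b ha hb
      have := (h.dg u a b).1 hb.symm
      subst this
      exact ha
    · rintro u v ⟨h1, h2⟩
      refine ⟨D.symm h1, fun a b ha hb => ?_⟩
      obtain ⟨σ, hσ⟩ := thin_perm h hE h2
      have e1 := hσ u v rfl
      have e2 := hσ b a (h.sy _ _ _ _ hb)
      rw [← Quotient.sound ha, ← e1] at e2
      exact E.symm (Quotient.exact (σ.injective e2))
    · rintro u v w ⟨h1, h2⟩ ⟨h3, h4⟩
      refine ⟨D.trans h1 h3, fun a b ha hb => ?_⟩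
      obtain ⟨v', hv1, hv2⟩ := h.ex hb.symm v
      exact h4 v' b (h2 a v' ha hv1) hv2

lemma coh_thinSetoid [Fintype V] (h : IsSch r) {E D : Setoid V}
    (hE : Coh r (fun u v => E u v)) (hD : Coh r (fun u v => D u v)) :
    Coh r (fun u v => thinSetoid h (D := D) hE u v) := by
  intro u v u' v' he
  change (D u v ∧ Thin r E u v) = (D u' v' ∧ Thin r E u' v')
  rw [coh_thin h hE _ _ _ _ he, propext (hD.iff he)]

lemma le_thinSetoid [Fintype V] (h : IsSch r) {E D : Setoid V}
    (hE : Coh r (fun u v => E u v)) (hED : E ≤ D) : E ≤ thinSetoid h (D := D) hE := by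
  intro u v huv
  refine ⟨hED huv, fun a b ha hb => ?_⟩
  have : E a b := (hE.iff hb).2 huv
  exact E.trans (E.symm huv) (E.trans ha this)

end A

section B

variable {V K : Type*} {r : V → V → K} [Fintype V]

/-- Sub-equivalence has valency dividing. -/
lemma deg_dvd (h : IsSch r) {E D : Setoid V} (hE : Coh r (fun u v => E u v)) (hED : E ≤ D)
    (u : V) : (Finset.univ.filter fun w => E u w).card ∣
      (Finset.univ.filter fun w => D u w).card := by
  rw [Finset.card_eq_sum_card_image (fun w => Quotient.mk E w)
    (Finset.univ.filter fun w => D u w)]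
  refine Finset.dvd_sum fun b hb => ?_
  simp only [Finset.mem_image, Finset.mem_filter, Finset.mem_univ, true_and] at hb
  obtain ⟨a, ha, rfl⟩ := hb
  rw [deg_const h hE u a]
  refine (congrArg Finset.card ?_).dvd
  ext w
  simp only [Finset.mem_filter, Finset.mem_univ, true_and]
  constructor
  · intro hw
    exact ⟨D.trans ha (hED hw), Quotient.sound (E.symm hw)⟩
  · rintro ⟨-, hw⟩
    exact E.symm (Quotient.exact hw)

/-- Colours between the blocks of `u` and `v`. -/
def rho (r : V → V → K) (E : Setoid V) (u v : V) : Set K :=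
  {c | ∃ u', E u u' ∧ ∃ v', r u' v' = c ∧ E v' v}

lemma rho_coh (h : IsSch r) {E : Setoid V} (hE : Coh r (fun u v => E u v)) :
    Coh r (rho r E) := by
  intro u v u' v' he
  ext c
  exact (coh_comp h hE (coh_comp h (coh_class c) hE)).iff he

lemma rho_block {E : Setoid V} {u v u' v' : V} (hu : E u u') (hv : E v v') :
    rho r E u v = rho r E u' v' := by
  ext c
  constructor
  · rintro ⟨a, ha, b, hb, hbv⟩
    exact ⟨a, E.trans (E.symm hu) ha, b, hb, E.trans hbv hv⟩
  · rintro ⟨a, ha, b, hb, hbv⟩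
    exact ⟨a, E.trans hu ha, b, hb, E.trans hbv (E.symm hv)⟩

lemma rho_iff (h : IsSch r) {E : Setoid V} (hE : Coh r (fun u v => E u v)) (u x y : V) :
    rho r E u y = rho r E u x ↔ r u x ∈ rho r E u y := by
  constructor
  · intro he
    rw [he]
    exact ⟨u, E.refl u, x, rfl, E.refl x⟩
  · rintro ⟨a, ha, b, hb, hby⟩
    rw [← rho_coh h hE _ _ _ _ hb]
    exact rho_block ha (E.symm hby)

/-- Valency of the double coset divides `n_E * n_R * n_E`. -/
lemma double_dvd (h : IsSch r) {E : Setoid V} (hE : Coh r (fun u v => E u v)) (u x : V) :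
    (Finset.univ.filter fun y => rho r E u y = rho r E u x).card ∣
      (Finset.univ.filter fun w => E u w).card * (Finset.univ.filter fun w => r u w = r u x).card *
      (Finset.univ.filter fun w => E u w).card := by
  let s : Finset (V × V) := Finset.univ.filter fun z => E u z.1 ∧ r z.1 z.2 = r u x
  let t : Finset V := Finset.univ.filter fun y => rho r E u y = rho r E u x
  let d : V → V → ℕ := fun a b => ∑ a', (if E a a' then 1 else 0) *
    (Finset.univ.filter fun w => r a' w = r u x ∧ E w b).card
  have hs : s.card = (Finset.univ.filter fun w => E u w).card *
      (Finset.univ.filter fun w => r u w = r u x).card := by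
    have : s = ((Finset.univ.filter fun w => E u w).sigma
        (fun a => Finset.univ.filter fun w => r a w = r u x)).map
          (Equiv.sigmaEquivProd V V).toEmbedding := by
      ext ⟨a, b⟩
      simp [s]
    rw [this, Finset.card_map, Finset.card_sigma, Finset.sum_const_nat]
    intro a _
    exact deg_const h (coh_class (r u x)) a u
  have hd : Coh r d := by
    refine coh_sum h ?_ (coh_card h (coh_class _) hE)
    intro a b a' b' he
    simp only [hE.iff he]
  have hdb : ∀ a b a' b', E a a' → E b b' → d a b = d a' b' := by
    intro a b a' b' ha hb
    refine Finset.sum_congr rfl fun c _ => ?_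
    have e1 : E a c ↔ E a' c := ⟨fun hh => E.trans (E.symm ha) hh, fun hh => E.trans ha hh⟩
    have e2 : ∀ w, E w b ↔ E w b' :=
      fun w => ⟨fun hh => E.trans hh hb, fun hh => E.trans hh (E.symm hb)⟩
    simp only [e1, e2]
  have hcount := Finset.card_mul_eq_card_mul (s := s) (t := t) (fun z y => E z.2 y)
    (m := (Finset.univ.filter fun w => E u w).card) (n := d u x) ?_ ?_
  · rw [← hs, hcount]
    exact dvd_mul_right _ _
  · rintro ⟨a, b⟩ hz
    simp only [s, Finset.mem_filter, Finset.mem_univ, true_and] at hz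
    rw [deg_const h hE u b]
    congr 1
    ext y
    simp only [t, Finset.mem_bipartiteAbove, Finset.mem_filter, Finset.mem_univ, true_and]
    constructor
    · exact fun hh => hh.2
    · intro hh
      exact ⟨(rho_iff h hE u x y).2 ⟨a, hz.1, b, hz.2, hh⟩, hh⟩
  · intro y hy
    simp only [t, Finset.mem_filter, Finset.mem_univ, true_and] at hy
    obtain ⟨a, ha, b, hb, hby⟩ := (rho_iff h hE u x y).1 hy
    have : d u x = d u y := by
      rw [hdb u y a b ha (E.symm hby)]
      exact (hd _ _ _ _ hb).symm
    rw [this]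
    simp only [Finset.bipartiteBelow, s, Finset.filter_filter, d]
    rw [Finset.card_filter, Fintype.sum_prod_type]
    refine Finset.sum_congr rfl fun a' _ => ?_
    rw [Finset.card_filter, Finset.mul_sum]
    refine Finset.sum_congr rfl fun b' _ => ?_
    by_cases h1 : E u a' <;> simp [h1]

/-- All colours inside `D` have `p`-power valency. -/
def Good (p : ℕ) (r : V → V → K) (D : Setoid V) : Prop :=
  ∀ u v, D u v → ∃ k, (Finset.univ.filter fun w => r u w = r u v).card = p ^ k

lemma step (h : IsSch r) {p : ℕ} (hp : p.Prime) [Nonempty V] {E D : Setoid V}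
    (hE : Coh r (fun u v => E u v)) (hD : Coh r (fun u v => D u v)) (hlt : E < D)
    (hG : Good p r D) (hn : ∀ u, ∃ k, (Finset.univ.filter fun w => D u w).card = p ^ k) :
    ∃ F : Setoid V, Coh r (fun u v => F u v) ∧ E < F ∧ F ≤ D ∧
      ∀ u v, F u v → Thin r E u v := by
  refine ⟨thinSetoid h (D := D) hE, coh_thinSetoid h hE hD, ?_, fun u v huv => huv.1,
    fun u v huv => huv.2⟩
  refine lt_of_le_of_ne (le_thinSetoid h hE hlt.le) fun heq => ?_
  have hT : ∀ u v, D u v → Thin r E u v → E u v := by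
    intro u v h1 h2
    rw [heq]
    exact ⟨h1, h2⟩
  obtain ⟨u, x0, hx0, hx0'⟩ : ∃ u v, D u v ∧ ¬ E u v := by
    by_contra hcon
    push Not at hcon
    exact hlt.not_ge fun u v huv => hcon u v huv
  obtain ⟨m, hm⟩ := hn u
  obtain ⟨e, -, he⟩ := (Nat.dvd_prime_pow hp).1 (hm ▸ deg_dvd h hE hlt.le u)
  have hEsub : (Finset.univ.filter fun w => E u w) ⊆ (Finset.univ.filter fun w => D u w) := by
    intro w hw
    simp only [Finset.mem_filter, Finset.mem_univ, true_and] at hw ⊢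
    exact hlt.le hw
  have hem : e < m := by
    rw [← Nat.pow_lt_pow_iff_right hp.one_lt, ← he, ← hm]
    refine Finset.card_lt_card ⟨hEsub, fun hh => hx0' ?_⟩
    have := @hh x0 (by simpa using hx0)
    simpa using this
  have hdiv : p ^ (e + 1) ∣
      ((Finset.univ.filter fun w => D u w) \ (Finset.univ.filter fun w => E u w)).card := by
    rw [Finset.card_eq_sum_card_image (fun w => rho r E u w)]
    refine Finset.dvd_sum fun b hb => ?_
    simp only [Finset.mem_image, Finset.mem_sdiff, Finset.mem_filter, Finset.mem_univ,
      true_and] at hb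
    obtain ⟨x, ⟨hxD, hxE⟩, rfl⟩ := hb
    have hfe : (((Finset.univ.filter fun w => D u w) \
        (Finset.univ.filter fun w => E u w)).filter fun a => rho r E u a = rho r E u x) =
        Finset.univ.filter fun y => rho r E u y = rho r E u x := by
      ext y
      simp only [Finset.mem_filter, Finset.mem_sdiff, Finset.mem_univ, true_and,
        and_iff_right_iff_imp]
      intro hy
      obtain ⟨a, ha, b, hb, hby⟩ := (rho_iff h hE u x y).1 hy
      refine ⟨D.trans (hlt.le ha) (D.trans ((hD.iff hb).2 hxD) (hlt.le hby)), fun hh => hxE ?_⟩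
      exact (hE.iff hb).1 (E.trans (E.symm ha) (E.trans hh (E.symm hby)))
    rw [hfe]
    obtain ⟨k, hk⟩ := hG u x hxD
    have hdd := double_dvd h hE u x
    rw [hk, he, ← pow_add, ← pow_add] at hdd
    obtain ⟨a, -, ha⟩ := (Nat.dvd_prime_pow hp).1 hdd
    rw [ha]
    refine pow_dvd_pow p ?_
    rw [Nat.succ_le_iff, ← Nat.pow_lt_pow_iff_right hp.one_lt, ← he, ← ha, deg_const h hE u x]
    have hnt : ¬ Thin r E u x := fun hh => hxE (hT u x hxD hh)
    unfold Thin at hnt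
    push Not at hnt
    obtain ⟨a, b, h1, h2, h3⟩ := hnt
    refine Finset.card_lt_card ⟨?_, fun hh => h3 ?_⟩
    · intro y hy
      simp only [Finset.mem_filter, Finset.mem_univ, true_and] at hy ⊢
      exact (rho_block (E.refl u) hy).symm
    · have := @hh b (by
        simp only [Finset.mem_filter, Finset.mem_univ, true_and]
        exact (rho_iff h hE u x b).2 ⟨a, h1, b, h2, E.refl b⟩)
      simpa using this
  have hsum := Finset.card_sdiff_add_card_eq_card hEsub
  rw [hm, he] at hsum
  have h2 : p ^ (e + 1) ∣ p ^ e :=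
    (Nat.dvd_add_right hdiv).1 (hsum ▸ pow_dvd_pow p hem)
  have := (Nat.pow_dvd_pow_iff_le_right hp.one_lt).1 h2
  omega

end B

section C

lemma finite_setoid (V : Type*) [Finite V] : Finite (Setoid V) := by
  refine Finite.of_injective (fun (E : Setoid V) (u v : V) => (E u v : Prop)) ?_
  intro E F hEF
  ext u v
  exact iff_of_eq (congrFun (congrFun hEF u) v)

/-- Colouring of a permutation all of whose cycle lengths are divisible by `p`. -/
lemma perm_color {X : Type*} (p : ℕ) (σ : Equiv.Perm X)
    (hσ : ∀ (n : ℤ) x, (σ ^ n) x = x → (p : ℤ) ∣ n) :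
    ∃ f : X → ZMod p, ∀ x, f (σ x) = f x + 1 := by
  let s := Equiv.Perm.SameCycle.setoid σ
  have hrep : ∀ x : X, ∃ n : ℤ, (σ ^ n) (Quotient.mk s x).out = x := by
    intro x
    exact Quotient.mk_out (s := s) x
  choose k hk using hrep
  refine ⟨fun x => (k x : ZMod p), fun x => ?_⟩
  have hq : Quotient.mk s (σ x) = Quotient.mk s x := by
    refine Quotient.sound ?_
    change σ.SameCycle (σ x) x
    exact Equiv.Perm.sameCycle_apply_left.2 (Equiv.Perm.SameCycle.refl σ x)
  have h1 := hk (σ x)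
  rw [hq] at h1
  have h2 := hk x
  have h3 : (σ ^ (k (σ x) - (k x + 1))) (Quotient.mk s x).out = (Quotient.mk s x).out := by
    apply (σ ^ (k x + 1)).injective
    rw [← Equiv.Perm.mul_apply, ← zpow_add, add_sub_cancel, h1, add_comm (k x), zpow_add,
      Equiv.Perm.mul_apply, h2, zpow_one]
  have h4 := hσ _ _ h3
  rw [← ZMod.intCast_zmod_eq_zero_iff_dvd] at h4
  push_cast at h4
  exact sub_eq_zero.1 h4

/-- A nontrivial permutation of a set of `p`-power size whose powers are semiregular. -/
lemma perm_dvd {X : Type*} [Fintype X] {p m : ℕ} (hp : p.Prime) (hX : Fintype.card X = p ^ m)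
    (σ : Equiv.Perm X) (h1 : σ ≠ 1) (hs : ∀ (n : ℕ) x, (σ ^ n) x = x → σ ^ n = 1) :
    p ∣ orderOf σ := by
  by_contra hcon
  have ho : orderOf σ ≠ 1 := fun hh => h1 (orderOf_eq_one_iff.1 hh)
  obtain ⟨q, hq, hqd⟩ := Nat.exists_prime_and_dvd ho
  have hqp : q ≠ p := fun hh => hcon (hh ▸ hqd)
  obtain ⟨t, ht⟩ := hqd
  have := Fact.mk hq
  have hpos := orderOf_pos σ
  have hnd : ¬ q ∣ Fintype.card X := by
    rw [hX]
    intro hh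
    exact hqp ((Nat.prime_dvd_prime_iff_eq hq hp).1 (hq.dvd_of_dvd_pow hh))
  obtain ⟨a, ha⟩ := Equiv.Perm.exists_fixed_point_of_prime (p := q) (n := 1) hnd (σ := σ ^ t) (by
    rw [← pow_mul, pow_one, mul_comm, ← ht, pow_orderOf_eq_one])
  have h2 := orderOf_dvd_of_pow_eq_one (hs t a ha)
  have htpos : 0 < t := by
    rcases Nat.eq_zero_or_pos t with h0 | h0
    · subst h0; omega
    · exact h0
  have h3 := Nat.le_of_dvd htpos h2
  rw [ht] at h3
  nlinarith [hq.two_le]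

variable {V K : Type*} {r : V → V → K}

/-- Walks of length `n` with all steps of colour `c`. -/
def Wk (r : V → V → K) (c : K) : ℕ → V → V → Prop
  | 0 => fun u v => u = v
  | n + 1 => fun u v => ∃ w, Wk r c n u w ∧ r w v = c

lemma coh_wk (h : IsSch r) (c : K) (n : ℕ) : Coh r (Wk r c n) := by
  induction n with
  | zero => exact coh_eq h
  | succ n ih => exact coh_comp h ih (coh_class c)

lemma wk_add (c : K) {m n : ℕ} {u v w : V} (h1 : Wk r c m u v) (h2 : Wk r c n v w) :
    Wk r c (m + n) u w := by
  induction n generalizing w with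
  | zero => exact h2 ▸ h1
  | succ n ih =>
    obtain ⟨x, hx, hxw⟩ := h2
    exact ⟨x, ih hx, hxw⟩

lemma wk_one {u v : V} : Wk r (r u v) 1 u v := ⟨u, rfl, rfl⟩

lemma wk_out (h : IsSch r) (u v : V) (n : ℕ) (a : V) : ∃ b, Wk r (r u v) n a b := by
  induction n with
  | zero => exact ⟨a, rfl⟩
  | succ n ih =>
    obtain ⟨b, hb⟩ := ih
    obtain ⟨b', hb'⟩ := h.out u v b
    exact ⟨b', b, hb, hb'⟩

lemma forward [Fintype V] [Nonempty V] (h : IsSch r) {p m : ℕ} (hp : p.Prime)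
    (hV : Fintype.card V = p ^ m) (hG : Good p r (⊤ : Setoid V)) (u0 v0 : V) (hne : u0 ≠ v0) :
    ∃ f : V → ZMod p, Surjective f ∧ ∀ u v, r u v = r u0 v0 → f v = f u + 1 := by
  have := finite_setoid V
  obtain ⟨E, hEm⟩ := (Set.toFinite {E : Setoid V | Coh r (fun u v => E u v) ∧ ¬ E u0 v0}).exists_maximal
    ⟨⊥, coh_eq h, hne⟩
  obtain ⟨hE, hE0⟩ := hEm.prop
  have hlt : E < ⊤ := lt_top_iff_ne_top.2 fun hh => hE0 (by rw [hh]; trivial)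
  have hdeg : ∀ u : V, (Finset.univ.filter fun w => (⊤ : Setoid V) u w).card = p ^ m := by
    intro u
    rw [← hV]
    refine congrArg Finset.card ?_
    ext w
    simp only [Finset.mem_filter, Finset.mem_univ, true_and, iff_true]
    trivial
  obtain ⟨F, hF, hEF, -, hFt⟩ := step h hp hE (D := ⊤) (fun _ _ _ _ _ => rfl) hlt hG
    (fun u => ⟨m, hdeg u⟩)
  have hF0 : F u0 v0 := by
    by_contra hcon
    exact hEF.not_ge (hEm.le_of_ge ⟨hF, hcon⟩ hEF.le)
  obtain ⟨σ, hσ⟩ := thin_perm h hE (hFt _ _ hF0)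
  have hσn : ∀ n u v, Wk r (r u0 v0) n u v → (σ ^ n) (Quotient.mk E u) = Quotient.mk E v := by
    intro n
    induction n with
    | zero => rintro u v rfl; rfl
    | succ n ih =>
      rintro u v ⟨w, hw, hwv⟩
      rw [pow_succ', Equiv.Perm.mul_apply, ih u w hw, hσ w v hwv]
  have hsemi : ∀ (n : ℕ) x, (σ ^ n) x = x → σ ^ n = 1 := by
    intro n x hx
    obtain ⟨u, rfl⟩ := Quotient.exists_rep x
    obtain ⟨v, hv⟩ := wk_out h u0 v0 n u
    rw [hσn n u v hv] at hx
    have huv : E u v := E.symm (Quotient.exact hx)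
    ext y
    obtain ⟨a, rfl⟩ := Quotient.exists_rep y
    obtain ⟨b, hb⟩ := h.out u v a
    rw [hσn n a b (((coh_wk h _ n).iff hb).2 hv)]
    exact Quotient.sound (E.symm ((hE.iff hb).2 huv))
  have hne1 : σ ≠ 1 := by
    intro hh
    have := hσ u0 v0 rfl
    rw [hh] at this
    exact hE0 (Quotient.exact this)
  have hcard : Fintype.card (Quotient E) ∣ p ^ m := by
    rw [← hV, ← Finset.card_univ (α := V), Finset.card_eq_sum_card_fiberwise
      (s := (Finset.univ : Finset V)) (f := fun w => Quotient.mk E w) (t := (Finset.univ : Finset (Quotient E))) (fun _ _ => Finset.mem_coe.2 (Finset.mem_univ _)),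
      Finset.sum_const_nat (m := (Finset.univ.filter fun w => E u0 w).card)]
    · rw [Finset.card_univ]
      exact dvd_mul_right _ _
    · intro x _
      obtain ⟨a, rfl⟩ := Quotient.exists_rep x
      rw [deg_const h hE u0 a]
      congr 1
      ext w
      simp only [Finset.mem_filter, Finset.mem_univ, true_and]
      exact ⟨fun hh => E.symm (Quotient.exact hh), fun hh => Quotient.sound (E.symm hh)⟩
  obtain ⟨k, -, hk⟩ := (Nat.dvd_prime_pow hp).1 hcard
  have hpd := perm_dvd hp hk σ hne1 hsemi
  obtain ⟨f, hf⟩ := perm_color p σ (by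
    intro n x hx
    have key : ∀ n : ℕ, (σ ^ n) x = x → (p : ℤ) ∣ n := by
      intro n hx
      exact_mod_cast hpd.trans (orderOf_dvd_of_pow_eq_one (hsemi n x hx))
    rcases Int.eq_nat_or_neg n with ⟨j, rfl | rfl⟩
    · exact key j (by simpa using hx)
    · rw [dvd_neg]
      refine key j ?_
      rw [zpow_neg, zpow_natCast, Equiv.Perm.inv_eq_iff_eq] at hx
      exact hx.symm)
  refine ⟨fun v => f (Quotient.mk E v), ?_, ?_⟩
  · have : NeZero p := ⟨hp.ne_zero⟩
    have hit : ∀ n x, f ((σ ^ n) x) = f x + (n : ℕ) := by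
      intro n x
      induction n with
      | zero => simp
      | succ n ih => rw [pow_succ', Equiv.Perm.mul_apply, hf, ih]; push_cast; ring
    intro z
    have := hit (z - f (Quotient.mk E u0)).val (Quotient.mk E u0)
    rw [ZMod.natCast_zmod_val, add_sub_cancel] at this
    obtain ⟨v, hv⟩ := Quotient.exists_rep ((σ ^ (z - f (Quotient.mk E u0)).val) (Quotient.mk E u0))
    exact ⟨v, by simp only [hv, this]⟩
  · intro u v huv
    simp only [← hσ u v huv, hf]

/-- If `D` is good then the intersection of a neighbourhood with a block has `p`-power size. -/
lemma block_pow [Fintype V] [Nonempty V] (h : IsSch r) {p : ℕ} (hp : p.Prime)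
    (hdeg : ∀ D : Setoid V, Coh r (fun u v => D u v) →
      ∀ u, ∃ k, (Finset.univ.filter fun w => D u w).card = p ^ k)
    {D : Setoid V} (hD : Coh r (fun u v => D u v)) (hG : Good p r D) (u0 w0 : V) :
    ∃ k, (Finset.univ.filter fun w => r u0 w = r u0 w0 ∧ D w w0).card = p ^ k := by
  have := finite_setoid V
  obtain ⟨E, hEm⟩ := (Set.toFinite {E : Setoid V | Coh r (fun u v => E u v) ∧ E ≤ D ∧
    ∃ k, (Finset.univ.filter fun w => r u0 w = r u0 w0 ∧ E w w0).card = p ^ k}).exists_maximal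
    ⟨⊥, coh_eq h, bot_le, 0, by
      rw [pow_zero, Finset.card_eq_one]
      refine ⟨w0, ?_⟩
      ext w
      simp only [Finset.mem_filter, Finset.mem_univ, true_and, Finset.mem_singleton]
      exact ⟨fun hh => hh.2, fun hh => ⟨by rw [hh], hh⟩⟩⟩
  obtain ⟨hE, hED, e, he⟩ := hEm.prop
  rcases eq_or_lt_of_le hED with rfl | hlt
  · exact ⟨e, he⟩
  exfalso
  obtain ⟨F, hF, hEF, hFD, hFt⟩ := step h hp hE hD hlt hG (hdeg D hD)
  refine hEF.not_ge (hEm.le_of_ge ⟨hF, hFD, ?_⟩ hEF.le)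
  -- the intermediate equivalence
  let P : V → V → Prop := fun w w' => F w w' ∧
    ∃ a, E w a ∧ ∃ u, r a u = r w0 u0 ∧ ∃ b, r u b = r u0 w0 ∧ E b w'
  have hPc : Coh r P := by
    have := coh_comp h hE (coh_comp h (coh_class (r w0 u0))
      (coh_comp h (coh_class (r u0 w0)) hE))
    intro a b a' b' hab
    simp only [P]
    rw [propext (hF.iff hab), propext (this.iff hab)]
  have hPr : ∀ w, P w w := by
    intro w
    obtain ⟨u, hu⟩ := h.inn u0 w0 w
    exact ⟨F.refl w, w, E.refl w, u, h.sy _ _ _ _ hu, w, hu, E.refl w⟩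
  have hPt : ∀ u v w, P u v → P v w → P u w := by
    rintro w1 w2 w3 ⟨hf1, a, ha, u, hu, b, hb, hb2⟩ ⟨hf2, a', ha', u', hu', b', hb', hb3⟩
    refine ⟨F.trans hf1 hf2, a, ha, u, hu, ?_⟩
    have hu'' := h.sy _ _ _ _ hu'
    obtain ⟨c, hc1, hc2⟩ := h.ex (hu''.trans hb.symm) b'
    refine ⟨c, hc1.trans hb', ?_⟩
    have hFab : F a' b' :=
      F.trans (F.symm (hEF.le ha')) (F.trans hf2 (F.symm (hEF.le hb3)))
    have hbc : r b c = r a' b' := h.sy _ _ _ _ hc2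
    have := hFt a' b' hFab b c (E.symm (E.trans hb2 ha')) hbc
    exact E.trans (E.symm this) hb3
  let G : Setoid V := ⟨P, hPr, fun {a b} => coh_symm h hPc hPt hPr a b, fun {a b c} => hPt a b c⟩
  have hG1 : ∀ y, P w0 y ↔ ∃ b, (r u0 b = r u0 w0 ∧ F b w0) ∧ E b y := by
    intro y
    constructor
    · rintro ⟨hf, a, ha, u, hu, b, hb, hby⟩
      have hu' := h.sy _ _ _ _ hu
      obtain ⟨c, hc1, hc2⟩ := h.ex hu' b
      have hFab : F a b := F.trans (F.symm (hEF.le ha)) (F.trans hf (F.symm (hEF.le hby)))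
      have hbc : E b c := hFt a b hFab w0 c (E.symm ha) (h.sy _ _ _ _ hc2)
      have hcy : E c y := E.trans (E.symm hbc) hby
      exact ⟨c, ⟨hc1.trans hb, F.trans (hEF.le hcy) (F.symm hf)⟩, hcy⟩
    · rintro ⟨b, ⟨hb, hf⟩, hby⟩
      exact ⟨F.trans (F.symm hf) (hEF.le hby), w0, E.refl _, u0, rfl, b, hb, hby⟩
  have hcount := Finset.card_mul_eq_card_mul
    (s := Finset.univ.filter fun w => r u0 w = r u0 w0 ∧ F w w0)
    (t := Finset.univ.filter fun w => G w0 w) (fun b y => E b y)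
    (m := (Finset.univ.filter fun w => E w0 w).card)
    (n := (Finset.univ.filter fun w => r u0 w = r u0 w0 ∧ E w w0).card) ?_ ?_
  · obtain ⟨g, hg⟩ := hdeg G hPc w0
    rw [hg, he, ← pow_add] at hcount
    obtain ⟨k, -, hk⟩ := (Nat.dvd_prime_pow hp).1 (Dvd.intro _ hcount)
    exact ⟨k, hk⟩
  · intro b hb
    simp only [Finset.mem_filter, Finset.mem_univ, true_and] at hb
    rw [deg_const h hE w0 b]
    congr 1
    ext y
    simp only [Finset.mem_bipartiteAbove, Finset.mem_filter, Finset.mem_univ, true_and]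
    refine ⟨fun hh => hh.2, fun hh => ⟨(hG1 y).2 ⟨b, hb, hh⟩, hh⟩⟩
  · intro y hy
    simp only [Finset.mem_filter, Finset.mem_univ, true_and] at hy
    obtain ⟨b, hb, hby⟩ := (hG1 y).1 hy
    refine Eq.trans ?_ (coh_card h (coh_class (r u0 w0)) hE u0 b u0 w0 hb.1)
    congr 1
    ext x
    simp only [Finset.mem_bipartiteBelow, Finset.mem_filter, Finset.mem_univ, true_and]
    constructor
    · rintro ⟨⟨h1, -⟩, h2⟩
      exact ⟨h1, E.trans h2 (E.symm hby)⟩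
    · rintro ⟨h1, h2⟩
      exact ⟨⟨h1, F.trans (hEF.le h2) hb.2⟩, E.trans h2 hby⟩

lemma all_good [Fintype V] [Nonempty V] (h : IsSch r) {p : ℕ} (hp : p.Prime)
    (hdeg : ∀ D : Setoid V, Coh r (fun u v => D u v) →
      ∀ u, ∃ k, (Finset.univ.filter fun w => D u w).card = p ^ k)
    (hcyc : ∀ u0 v0, u0 ≠ v0 → ∃ f : V → ZMod p, ∀ u v, r u v = r u0 v0 → f v = f u + 1)
    (D : Setoid V) (hD : Coh r (fun u v => D u v)) : Good p r D := by
  have := finite_setoid V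
  induction D using WellFoundedLT.induction with
  | ind D ih =>
  intro u v huv
  by_cases hne : u = v
  · subst hne
    refine ⟨0, ?_⟩
    rw [pow_zero, Finset.card_eq_one]
    refine ⟨u, ?_⟩
    ext w
    simp only [Finset.mem_filter, Finset.mem_univ, true_and, Finset.mem_singleton]
    rw [eq_comm, h.dg, eq_comm]
  obtain ⟨f, hf⟩ := hcyc u v hne
  have hfw : ∀ n a b, Wk r (r u v) n a b → f b = f a + (n : ℕ) := by
    intro n
    induction n with
    | zero => rintro a b rfl; simp
    | succ n ih2 =>
      rintro a b ⟨w, hw, hwb⟩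
      rw [hf w b hwb, ih2 a w hw]
      push_cast
      ring
  let P : V → V → Prop := fun a b => ∃ n, p ∣ n ∧ Wk r (r u v) n a b
  have hPc : Coh r P := by
    intro a b a' b' hab
    refine propext (exists_congr fun n => ?_)
    rw [(coh_wk h (r u v) n).iff hab]
  have hPr : ∀ w, P w w := fun w => ⟨0, dvd_zero _, rfl⟩
  have hPt : ∀ a b c, P a b → P b c → P a c := by
    rintro a b c ⟨m, hm, h1⟩ ⟨n, hn, h2⟩
    exact ⟨m + n, dvd_add hm hn, wk_add _ h1 h2⟩
  have hPs := coh_symm h hPc hPt hPr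
  let G : Setoid V := ⟨P, hPr, fun {a b} => hPs a b, fun {a b c} => hPt a b c⟩
  have hwD : ∀ n a b, Wk r (r u v) n a b → D a b := by
    intro n
    induction n with
    | zero => rintro a b rfl; exact D.refl a
    | succ n ih2 =>
      rintro a b ⟨w, hw, hwb⟩
      exact D.trans (ih2 a w hw) ((hD.iff hwb).2 huv)
  have hlt : G < D := by
    refine lt_of_le_of_ne ?_ ?_
    · rintro a b ⟨n, -, hn⟩
      exact hwD n a b hn
    · intro hh
      have hG : G u v := by rw [hh]; exact huv
      obtain ⟨n, hn, hw⟩ := hG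
      have h1 := hfw n u v hw
      rw [(ZMod.natCast_eq_zero_iff n p).2 hn, hf u v rfl] at h1
      have := Fact.mk hp
      simp at h1
  obtain ⟨k, hk⟩ := block_pow h hp hdeg hPc (ih G hlt hPc) u v
  refine ⟨k, hk ▸ congrArg Finset.card ?_⟩
  ext w
  simp only [Finset.mem_filter, Finset.mem_univ, true_and]
  refine ⟨fun hw => ⟨hw, ?_⟩, fun hw => hw.1⟩
  obtain ⟨z, hz⟩ := wk_out h u v (p - 1) v
  have hp1 : 1 + (p - 1) = p := by have := hp.two_le; omega
  have huz : P u z := ⟨1 + (p - 1), by rw [hp1], wk_add _ wk_one hz⟩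
  obtain ⟨n, hn, hzu⟩ := hPs _ _ huz
  refine hPs _ _ ⟨(p - 1) + n + 1, ?_, wk_add _ (wk_add _ hz hzu) (hw ▸ wk_one)⟩
  have : p - 1 + n + 1 = n + p := by omega
  rw [this]
  exact dvd_add hn dvd_rfl

end C

section D

variable {V K : Type*} {r : V → V → K}

lemma coh_list_prod [Fintype V] (h : IsSch r) (L : List (Matrix V V ℕ))
    (hL : ∀ M ∈ L, Coh r (fun u v => M u v)) : Coh r (fun u v => L.prod u v) := by
  induction L with
  | nil =>
    intro u v u' v' he
    simp only [List.prod_nil, Matrix.one_apply, (coh_eq h).iff he]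
  | cons M L ih =>
    have := coh_sum h (hL M (by simp)) (ih fun N hN => hL N (by simp [hN]))
    intro u v u' v' he
    simp only [List.prod_cons, Matrix.mul_apply]
    exact this u v u' v' he

lemma sum_pow_words {R K : Type*} [Semiring R] [Fintype K] (A : K → R) (n : ℕ) :
    (∑ c, A c) ^ n = ∑ w : Fin n → K, (List.ofFn fun i => A (w i)).prod := by
  induction n with
  | zero => simp
  | succ n ih =>
    rw [pow_succ', ih, ← (Fin.consEquiv fun _ => K).sum_comp, Fintype.sum_prod_type,
      Finset.sum_mul]
    refine Finset.sum_congr rfl fun c _ => ?_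
    rw [Finset.mul_sum]
    refine Finset.sum_congr rfl fun w _ => ?_
    simp [List.ofFn_succ, Fin.consEquiv]

lemma trace_coh [Fintype V] (h : IsSch r) (M : Matrix V V ℕ) (hM : Coh r (fun u v => M u v))
    (u : V) : M.trace = Fintype.card V * M u u := by
  rw [Matrix.trace, Finset.sum_const_nat (m := M u u), Finset.card_univ]
  intro x _
  exact hM x x u u (h.dg' x u)

lemma weight_rot [Fintype V] [Nonempty V] (h : IsSch r) (A : K → Matrix V V ℕ)
    (hA : ∀ c, Coh r (fun u v => A c u v)) (n : ℕ) (w : Fin (n + 1) → K) (u : V) :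
    (List.ofFn fun i => A (w (finRotate (n + 1) i))).prod u u =
      (List.ofFn fun i => A (w i)).prod u u := by
  have hc : ∀ w : Fin (n + 1) → K, Coh r (fun u v => (List.ofFn fun i => A (w i)).prod u v) := by
    intro w
    refine coh_list_prod h _ fun M hM => ?_
    obtain ⟨i, rfl⟩ := (List.mem_ofFn' _ _).1 hM
    exact hA _
  have h1 := trace_coh h _ (hc w) u
  have h2 := trace_coh h _ (hc fun i => w (finRotate (n + 1) i)) u
  have h3 : (List.ofFn fun i => A (w (finRotate (n + 1) i))).prod.trace =
      (List.ofFn fun i => A (w i)).prod.trace := by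
    rw [List.ofFn_succ', List.ofFn_succ (f := fun i => A (w i)), List.concat_eq_append,
      List.prod_append, List.prod_singleton, List.prod_cons, Matrix.trace_mul_comm]
    simp
  have hpos : 0 < Fintype.card V := Fintype.card_pos
  exact Nat.eq_of_mul_eq_mul_left hpos (by rw [← h1, ← h2, h3])

lemma deg_not_dvd [Fintype V] [Nonempty V] [Fintype K] (h : IsSch r) {p q : ℕ} (hp : p.Prime)
    (hq : q.Prime) (hqp : q ≠ p)
    (hcyc : ∀ u0 v0, u0 ≠ v0 → ∃ f : V → ZMod p, ∀ u v, r u v = r u0 v0 → f v = f u + 1)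
    (D : Setoid V) (hD : Coh r (fun u v => D u v)) (u : V) :
    ¬ q ∣ (Finset.univ.filter fun w => D u w).card := by
  obtain ⟨n, rfl⟩ : ∃ n, q = n + 1 := ⟨q - 1, by have := hq.two_le; omega⟩
  set d := (Finset.univ.filter fun w => D u w).card with hd
  let A : K → Matrix V V ℕ := fun c => Matrix.of fun a b => if D a b ∧ r a b = c then 1 else 0
  have hA : ∀ c, Coh r (fun u v => A c u v) := by
    intro c a b a' b' he
    simp only [A, Matrix.of_apply, hD.iff he, he]
  let wt : (Fin (n + 1) → K) → ℕ := fun w => (List.ofFn fun i => A (w i)).prod u u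
  have hrot : ∀ w, wt (fun i => w (finRotate (n + 1) i)) = wt w :=
    fun w => weight_rot h A hA n w u
  -- total weight
  have hAD : ∀ a b, (∑ c, A c) a b = if D a b then 1 else 0 := by
    intro a b
    rw [Matrix.sum_apply]
    simp only [A, Matrix.of_apply]
    by_cases hab : D a b <;> simp [hab]
  have hpow : ∀ m a b, ((∑ c, A c) ^ (m + 1)) a b = if D a b then d ^ m else 0 := by
    intro m
    induction m with
    | zero => intro a b; simp [hAD]
    | succ m ih =>
      intro a b
      rw [pow_succ, Matrix.mul_apply]
      simp only [ih, hAD]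
      by_cases hab : D a b
      · have : ∀ x, (if D a x then d ^ m else 0) * (if D x b then 1 else 0) =
            if D a x then d ^ m else 0 := by
          intro x
          by_cases hx : D a x
          · have : D x b := D.trans (D.symm hx) hab
            simp [hx, this]
          · simp [hx]
        simp only [this, hab, if_true]
        rw [← Finset.sum_filter, Finset.sum_const, deg_const h hD a u, ← hd, smul_eq_mul, pow_succ,
          mul_comm]
      · rw [if_neg hab]
        refine Finset.sum_eq_zero fun x _ => ?_
        by_cases hx : D a x
        · have : ¬ D x b := fun hh => hab (D.trans hx hh)
          simp [this]
        · simp [hx]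
  have htot : ∑ w, wt w = d ^ n := by
    have h1 := hpow n u u
    rw [sum_pow_words, Matrix.sum_apply, if_pos (D.refl u)] at h1
    exact h1
  -- constant words
  have hconst : ∀ c, wt (fun _ => c) = ((A c) ^ (n + 1)) u u := by
    intro c
    simp only [wt, List.ofFn_const, List.prod_replicate]
  have hone : wt (fun _ => r u u) = 1 := by
    have : A (r u u) = 1 := by
      ext a b
      simp only [A, Matrix.of_apply, Matrix.one_apply]
      have : (D a b ∧ r a b = r u u) ↔ a = b := by
        rw [eq_comm (a := r a b), h.dg]
        exact ⟨fun hh => hh.2, fun hh => ⟨hh ▸ D.refl a, hh⟩⟩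
      simp only [this]
    rw [hconst, this, one_pow, Matrix.one_apply_eq]
  have hzero : ∀ c, wt (fun _ => c) ≠ 0 → c = r u u := by
    intro c hc
    by_contra hne
    rw [hconst] at hc
    by_cases hex : ∃ a b, r a b = c
    · obtain ⟨a0, b0, rfl⟩ := hex
      have hab : a0 ≠ b0 := fun hh => hne (hh ▸ h.dg' a0 u)
      obtain ⟨f, hf⟩ := hcyc a0 b0 hab
      have key : ∀ m a b, ((A (r a0 b0)) ^ m) a b ≠ 0 → f b = f a + (m : ℕ) := by
        intro m
        induction m with
        | zero =>
          intro a b hh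
          have : a = b := by
            by_contra h0
            exact hh (by rw [pow_zero, Matrix.one_apply_ne h0])
          simp [this]
        | succ m ih =>
          intro a b hh
          rw [pow_succ, Matrix.mul_apply] at hh
          obtain ⟨x, -, hx⟩ := Finset.exists_ne_zero_of_sum_ne_zero hh
          have h1 := ih a x (left_ne_zero_of_mul hx)
          have h2 := right_ne_zero_of_mul hx
          simp only [A, Matrix.of_apply, ne_eq, ite_eq_right_iff, not_forall] at h2
          rw [hf x b h2.1.2, h1]
          push_cast
          ring
      have h1 := key _ _ _ hc
      rw [left_eq_add, ZMod.natCast_eq_zero_iff] at h1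
      exact hqp ((Nat.prime_dvd_prime_iff_eq hp hq).1 h1).symm
    · have : A c = 0 := by
        ext a b
        simp only [A, Matrix.of_apply, Matrix.zero_apply]
        rw [if_neg]
        exact fun hh => hex ⟨a, b, hh.2⟩
      rw [this, zero_pow (by omega)] at hc
      exact hc rfl
  -- the shift
  let X := Σ w : Fin (n + 1) → K, Fin (wt w)
  have hXext : ∀ x y : X, x.1 = y.1 → x.2.val = y.2.val → x = y := by
    rintro ⟨w, i⟩ ⟨w', j⟩ h1 h2
    dsimp only at h1
    subst h1
    have : i = j := Fin.ext h2
    rw [this]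
  let g : Function.End X := fun x =>
    ⟨fun i => x.1 (finRotate (n + 1) i), Fin.cast (hrot x.1).symm x.2⟩
  have hg : ∀ (m : ℕ) (x : X), (∀ i, ((g ^ m) x).1 i = x.1 (((finRotate (n + 1)) ^ m) i)) ∧
      ((g ^ m) x).2.val = x.2.val := by
    intro m
    induction m with
    | zero => exact fun x => ⟨fun i => rfl, rfl⟩
    | succ m ih =>
      intro x
      have e : (g ^ (m + 1)) x = (g ^ m) (g x) := by rw [pow_succ]; rfl
      rw [e]
      refine ⟨fun i => ?_, ?_⟩
      · rw [(ih (g x)).1 i, pow_succ', Equiv.Perm.mul_apply]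
      · rw [(ih (g x)).2]
        rfl
  have hrq : (finRotate (n + 1)) ^ (n + 1) = 1 := by
    obtain ⟨k, rfl⟩ : ∃ k, n = k + 1 := ⟨n - 1, by have := hq.two_le; omega⟩
    have h1 := (isCycle_finRotate (n := k)).orderOf
    rw [support_finRotate, Finset.card_univ, Fintype.card_fin] at h1
    have h2 := pow_orderOf_eq_one (finRotate (k + 2))
    rwa [h1] at h2
  have hgq : g ^ (n + 1) ^ 1 = 1 := by
    rw [pow_one]
    funext x
    refine hXext _ _ ?_ ?_
    · funext i
      rw [(hg (n + 1) x).1 i, hrq]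
      rfl
    · rw [(hg (n + 1) x).2]
      rfl
  have := Fact.mk hq
  have hmod := Equiv.Perm.card_fixedPoints_modEq (p := n + 1) (n := 1) hgq
  have hcX : Fintype.card X = d ^ n := by
    rw [← htot, Fintype.card_sigma]
    simp only [Fintype.card_fin]
  have hfix : Fintype.card (Function.fixedPoints g) = 1 := by
    rw [Fintype.card_eq_one_iff]
    let x0 : X := ⟨fun _ => r u u, ⟨0, by rw [hone]; exact one_pos⟩⟩
    have hx0 : g x0 = x0 := hXext _ _ rfl rfl
    refine ⟨⟨x0, hx0⟩, ?_⟩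
    rintro ⟨⟨w, i⟩, hx⟩
    have hw : ∀ j, w (finRotate (n + 1) j) = w j := by
      intro j
      have : (g ⟨w, i⟩).1 j = w j := by rw [hx]
      exact this
    have hwc : ∀ j, w j = w 0 := by
      intro j
      induction j using Fin.induction with
      | zero => rfl
      | succ j ih =>
        have := hw j.castSucc
        rw [ih] at this
        simpa using this
    have hwe : w = fun _ => w 0 := funext hwc
    have hlt := i.2
    have hne : wt (fun _ => w 0) ≠ 0 := by
      rw [← hwe]
      omega
    have hw0 := hzero _ hne
    have hwe2 : w = fun _ => r u u := by rw [hwe, hw0]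
    have hwt : wt w = 1 := by rw [hwe2, hone]
    refine Subtype.ext (hXext _ _ hwe2 ?_)
    change i.val = 0
    omega
  rw [hcX, hfix] at hmod
  intro hdvd
  have hn : n ≠ 0 := by have := hq.two_le; omega
  have h1 : n + 1 ∣ d ^ n := hdvd.trans (dvd_pow_self d hn)
  have h2 : n + 1 ∣ 1 := (hmod.dvd_iff dvd_rfl).1 h1
  exact hq.one_lt.ne' (Nat.dvd_one.1 h2)

lemma deg_pow [Fintype V] [Nonempty V] [Fintype K] (h : IsSch r) {p : ℕ} (hp : p.Prime)
    (hcyc : ∀ u0 v0, u0 ≠ v0 → ∃ f : V → ZMod p, ∀ u v, r u v = r u0 v0 → f v = f u + 1)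
    (D : Setoid V) (hD : Coh r (fun u v => D u v)) (u : V) :
    ∃ k, (Finset.univ.filter fun w => D u w).card = p ^ k := by
  refine ⟨_, Nat.eq_prime_pow_of_unique_prime_dvd ?_ ?_⟩
  · refine Finset.card_ne_zero_of_mem (a := u) ?_
    simp
  · intro q hq hqd
    by_contra hne
    exact deg_not_dvd h hp hq hne hcyc D hD u hqd

end D

section Final

variable {V : Type*} [Fintype V]

/-- The class of a pair. -/
noncomputable def rc (C : AssocScheme V) (u v : V) : Set (V × V) := (C.part (u, v)).choose

lemma rc_mem (C : AssocScheme V) (u v : V) : rc C u v ∈ C.classes :=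
  (C.part (u, v)).choose_spec.1.1

lemma mem_rc (C : AssocScheme V) (u v : V) : (u, v) ∈ rc C u v :=
  (C.part (u, v)).choose_spec.1.2

lemma rc_eq (C : AssocScheme V) {R : Set (V × V)} (hR : R ∈ C.classes) (u v : V) :
    rc C u v = R ↔ (u, v) ∈ R :=
  ⟨fun hh => hh ▸ mem_rc C u v, fun hh => ((C.part (u, v)).choose_spec.2 R ⟨hR, hh⟩).symm⟩

lemma rc_diag (C : AssocScheme V) (u v : V) : rc C u v = diag V ↔ u = v :=
  rc_eq C C.diag_mem u v

lemma isSch (C : AssocScheme V) : IsSch (rc C) where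
  dg u v w := by
    rw [(rc_diag C u u).2 rfl, eq_comm, rc_diag]
  sy u v u' v' he := by
    have h1 : rc C v u = transp (rc C u v) :=
      (rc_eq C (C.transp_mem _ (rc_mem C u v)) v u).2 (mem_rc C u v)
    have h2 : rc C v' u' = transp (rc C u' v') :=
      (rc_eq C (C.transp_mem _ (rc_mem C u' v')) v' u').2 (mem_rc C u' v')
    rw [h1, h2, he]
  tri u v u' v' he := by
    have key : ∀ c : Set (V × V) × Set (V × V),
        Nonempty ({w // (rc C u w, rc C w v) = c} ≃ {w // (rc C u' w, rc C w v') = c}) := by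
      rintro ⟨R, S⟩
      refine ⟨Fintype.equivOfCardEq ?_⟩
      by_cases hR : R ∈ C.classes
      · by_cases hS : S ∈ C.classes
        · have h1 := C.inter R hR S hS (rc C u v) (rc_mem C u v) (u, v) (mem_rc C u v)
            (u', v') (he ▸ mem_rc C u' v')
          simp only [Prod.mk.injEq, rc_eq C hR, rc_eq C hS]
          rw [← Nat.card_eq_fintype_card, ← Nat.card_eq_fintype_card]
          exact h1
        · have e1 : IsEmpty {w // (rc C u w, rc C w v) = (R, S)} :=
            ⟨fun w => hS ((Prod.mk.inj w.2).2 ▸ rc_mem C _ _)⟩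
          have e2 : IsEmpty {w // (rc C u' w, rc C w v') = (R, S)} :=
            ⟨fun w => hS ((Prod.mk.inj w.2).2 ▸ rc_mem C _ _)⟩
          rw [Fintype.card_eq_zero, Fintype.card_eq_zero]
      · have e1 : IsEmpty {w // (rc C u w, rc C w v) = (R, S)} :=
          ⟨fun w => hR ((Prod.mk.inj w.2).1 ▸ rc_mem C _ _)⟩
        have e2 : IsEmpty {w // (rc C u' w, rc C w v') = (R, S)} :=
          ⟨fun w => hR ((Prod.mk.inj w.2).1 ▸ rc_mem C _ _)⟩
        rw [Fintype.card_eq_zero, Fintype.card_eq_zero]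
    refine ⟨Equiv.ofFiberEquiv fun c => (key c).some, fun w => ?_⟩
    have := Equiv.ofFiberEquiv_map (fun c => (key c).some) w
    exact Prod.mk.inj this

lemma ncard_rc (C : AssocScheme V) (u v : V) : (rc C u v).ncard =
    Fintype.card V * (Finset.univ.filter fun w => rc C u w = rc C u v).card := by
  have : rc C u v = (((Finset.univ : Finset V).sigma
      (fun a => Finset.univ.filter fun w => rc C a w = rc C u v)).map
          (Equiv.sigmaEquivProd V V).toEmbedding : Finset (V × V)) := by
    ext ⟨a, b⟩
    simp [rc_eq C (rc_mem C u v)]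
  rw [this, Set.ncard_coe_finset, Finset.card_map, Finset.card_sigma, Finset.sum_const_nat,
    Finset.card_univ, ← this]
  intro a _
  exact deg_const (isSch C) (coh_class (rc C u v)) a u

lemma main {p : ℕ} (hp : p.Prime) (C : AssocScheme V) :
    IsPScheme p C ↔ ∀ R ∈ C.classes, R ≠ diag V → CyclicallyPartite p R := by
  have h := isSch C
  obtain ⟨⟨o, -⟩, -⟩ := C.nonempty_mem _ C.diag_mem
  have : Nonempty V := ⟨o⟩
  constructor
  · intro hC R hR hRd
    have hdvd : ∀ u v, ∃ k, Fintype.card V *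
        (Finset.univ.filter fun w => rc C u w = rc C u v).card = p ^ k := by
      intro u v
      obtain ⟨k, hk⟩ := hC _ (rc_mem C u v)
      exact ⟨k, by rw [← ncard_rc, hk]⟩
    obtain ⟨k0, hk0⟩ := hdvd o o
    obtain ⟨m, -, hm⟩ := (Nat.dvd_prime_pow hp).1 (Dvd.intro _ hk0)
    have hG : Good p (rc C) (⊤ : Setoid V) := by
      intro u v _
      obtain ⟨k, hk⟩ := hdvd u v
      obtain ⟨j, -, hj⟩ := (Nat.dvd_prime_pow hp).1 (Dvd.intro_left _ hk)
      exact ⟨j, hj⟩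
    obtain ⟨⟨u0, v0⟩, h0⟩ := C.nonempty_mem R hR
    have hr := (rc_eq C hR u0 v0).2 h0
    have hne : u0 ≠ v0 := by
      intro hh
      exact hRd (hr.symm.trans ((rc_diag C u0 v0).2 hh))
    obtain ⟨f, hf, hf2⟩ := forward h hp hm hG u0 v0 hne
    exact ⟨f, hf, fun u v huv => hf2 u v (by rw [hr, rc_eq C hR]; exact huv)⟩
  · intro hC
    have hcyc : ∀ u0 v0, u0 ≠ v0 →
        ∃ f : V → ZMod p, ∀ u v, rc C u v = rc C u0 v0 → f v = f u + 1 := by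
      intro u0 v0 hne
      obtain ⟨f, -, hf⟩ := hC _ (rc_mem C u0 v0) (fun hh => hne ((rc_diag C u0 v0).1 hh))
      exact ⟨f, fun u v huv => hf u v ((rc_eq C (rc_mem C u0 v0) u v).1 huv)⟩
    have hdeg := deg_pow h hp hcyc
    have hgood := all_good h hp hdeg hcyc ⊤ (fun _ _ _ _ _ => rfl)
    intro R hR
    obtain ⟨⟨u0, v0⟩, h0⟩ := C.nonempty_mem R hR
    rw [← (rc_eq C hR u0 v0).2 h0, ncard_rc]
    obtain ⟨a, ha⟩ := hdeg ⊤ (fun _ _ _ _ _ => rfl) o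
    obtain ⟨b, hb⟩ := hgood u0 v0 trivial
    have hV : Fintype.card V = p ^ a := by
      rw [← ha, ← Finset.card_univ]
      refine congrArg Finset.card ?_
      ext w
      simp only [Finset.mem_filter, Finset.mem_univ, true_and, true_iff]
      trivial
    refine ⟨a + b, ?_⟩
    rw [hV, pow_add]
    congr 1

end Final

end PSch

/-- Theorem 1.1: an association scheme is a `p`-scheme iff each of its
non-reflexive basis digraphs is cyclically `p`-partite. -/
theorem pScheme_iff_cyclicallyPartite {V : Type*} [Fintype V] {p : ℕ} (hp : p.Prime)
    (C : AssocScheme V) :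
    IsPScheme p C ↔ ∀ R ∈ C.classes, R ≠ diag V → CyclicallyPartite p R := PSch.main hp C
end

section
/- Let C be a coherent configuration (not necessarily homogeneous). Then C is a 2-scheme if and only if every basis graph of C is bipartite. -/
open Set Function

/-- A coherent configuration on a finite set `V` (not necessarily homogeneous). -/
structure CoherentConfig (V : Type*) [Fintype V] where
  classes : Set (Set (V × V))
  part : ∀ x : V × V, ∃! R, R ∈ classes ∧ x ∈ R
  nonempty_mem : ∀ R ∈ classes, R.Nonempty
  transp_mem : ∀ R ∈ classes, transp R ∈ classes
  diag_union : ∃ D ⊆ classes, diag V = ⋃₀ D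
  inter : ∀ R ∈ classes, ∀ S ∈ classes, ∀ T ∈ classes, ∀ x ∈ T, ∀ y ∈ T,
    ({w : V | (Prod.fst x, w) ∈ R ∧ (w, Prod.snd x) ∈ S}).ncard =
    ({w : V | (Prod.fst y, w) ∈ R ∧ (w, Prod.snd y) ∈ S}).ncard

/-- A coherent configuration is a `p`-scheme if every basis relation has cardinality a power
of `p`. -/
def IsPSchemeCC (p : ℕ) {V : Type*} [Fintype V] (C : CoherentConfig V) : Prop :=
  ∀ R ∈ C.classes, ∃ k : ℕ, R.ncard = p ^ k

namespace TS
set_option linter.unusedSectionVars false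
set_option linter.unusedVariables false
open scoped Classical
open Finset

variable {V ι : Type*} [Fintype V]

/-- Abstract colouring form of a coherent configuration. -/
structure CC (c : V → V → ι) : Prop where
  diag : ∀ {x y x' y'}, c x y = c x' y' → x = y → x' = y'
  symm : ∀ {x y x' y'}, c x y = c x' y' → c y x = c y' x'
  inter : ∀ {x y x' y'}, c x y = c x' y' → ∀ r s,
    (Finset.univ.filter fun w => c x w = r ∧ c w y = s).card =
    (Finset.univ.filter fun w => c x' w = r ∧ c w y' = s).card

/-- Functions of pairs which are constant on colour classes. -/
def Coh {α : Type*} (c : V → V → ι) (M : V → V → α) : Prop :=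
  ∀ x y x' y', c x y = c x' y' → M x y = M x' y'

/-- relational composition -/
def rc (A B : V → V → Prop) : V → V → Prop := fun x y => ∃ w, A x w ∧ B w y

/-- out-degree -/
noncomputable def deg (A : V → V → Prop) (x : V) : ℕ := (Finset.univ.filter fun y => A x y).card

/-- 0/1 matrix of a relation -/
noncomputable def ind (K : Type*) [Zero K] [One K] (A : V → V → Prop) : Matrix V V K :=
  fun x y => if A x y then 1 else 0

variable {c : V → V → ι}

theorem CC.path (h : CC c) {x y x' y' w : V} (e : c x y = c x' y') :
    ∃ w', c x' w' = c x w ∧ c w' y' = c w y := by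
  have := h.inter e (c x w) (c w y)
  have h1 : 0 < (Finset.univ.filter fun w' => c x w' = c x w ∧ c w' y = c w y).card :=
    Finset.card_pos.2 ⟨w, by simp⟩
  rw [this, Finset.card_pos] at h1
  obtain ⟨w', hw⟩ := h1
  exact ⟨w', by simpa using hw⟩

theorem Coh.of_imp {A : V → V → Prop}
    (h : ∀ x y x' y', c x y = c x' y' → A x y → A x' y') : Coh c A :=
  fun x y x' y' e => propext ⟨h _ _ _ _ e, h _ _ _ _ e.symm⟩

theorem Coh.imp {A : V → V → Prop} (h : Coh c A) {x y x' y' : V} (e : c x y = c x' y')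
    (a : A x y) : A x' y' := (h _ _ _ _ e) ▸ a

theorem CC.coh_rc (h : CC c) {A B : V → V → Prop} (hA : Coh c A) (hB : Coh c B) :
    Coh c (rc A B) := by
  apply Coh.of_imp
  rintro x y x' y' e ⟨w, h1, h2⟩
  obtain ⟨w', e1, e2⟩ := h.path (w := w) e
  exact ⟨w', hA.imp e1.symm h1, hB.imp e2.symm h2⟩

theorem coh_col (r : ι) : Coh c (fun a b => c a b = r) :=
  Coh.of_imp fun _ _ _ _ e a => e ▸ a

theorem coh_true : Coh c (fun _ _ => True) := fun _ _ _ _ _ => rfl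

theorem CC.fib_left (h : CC c) {x y x' y' : V} (e : c x y = c x' y') : c x x = c x' x' := by
  have h1 : Coh c (fun u v => u = v ∧ c u u = c x x) := by
    apply Coh.of_imp
    rintro u v u' v' e ⟨rfl, h2⟩
    obtain rfl := h.diag e rfl
    exact ⟨rfl, e ▸ h2⟩
  obtain ⟨w, ⟨rfl, h2⟩, -⟩ := (h.coh_rc h1 coh_true).imp e ⟨x, ⟨rfl, rfl⟩, trivial⟩
  exact h2.symm

theorem CC.fib_right (h : CC c) {x y x' y' : V} (e : c x y = c x' y') : c y y = c y' y' :=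
  h.fib_left (h.symm e)

theorem CC.coh_swap (h : CC c) {α : Type*} {A : V → V → α} (hA : Coh c A) :
    Coh c (fun a b => A b a) := fun _ _ _ _ e => hA _ _ _ _ (h.symm e)

theorem CC.coh_mul [Fintype ι] (h : CC c) {K : Type*} [Semiring K] {M N : Matrix V V K}
    (hM : Coh c M) (hN : Coh c N) : Coh c (M * N) := by
  have key : ∀ (M : Matrix V V K), Coh c M → ∃ m : ι → K, ∀ x y, M x y = m (c x y) := by
    intro M hM
    refine ⟨fun r => if hr : ∃ p : V × V, c p.1 p.2 = r then M hr.choose.1 hr.choose.2 else 0, ?_⟩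
    intro x y
    have hr : ∃ p : V × V, c p.1 p.2 = c x y := ⟨(x, y), rfl⟩
    simp only [dif_pos hr]
    exact hM _ _ _ _ hr.choose_spec.symm
  obtain ⟨m, hm⟩ := key M hM
  obtain ⟨n, hn⟩ := key N hN
  have key2 : ∀ x y, (M * N) x y = ∑ p : ι × ι,
      (Finset.univ.filter fun w => c x w = p.1 ∧ c w y = p.2).card • (m p.1 * n p.2) := by
    intro x y
    rw [Matrix.mul_apply]
    rw [← Finset.sum_fiberwise (s := Finset.univ) (g := fun w => (c x w, c w y))]
    apply Finset.sum_congr rfl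
    rintro ⟨r, s⟩ -
    rw [← Finset.sum_const]
    apply Finset.sum_congr
    · ext w; simp
    · intro w hw
      simp at hw
      rw [hm, hn, hw.1, hw.2]
  intro x y x' y' e
  rw [key2, key2]
  apply Finset.sum_congr rfl
  rintro ⟨r, s⟩ -
  rw [h.inter e]

theorem coh_ind {K : Type*} [Zero K] [One K] {A : V → V → Prop} (hA : Coh c A) :
    Coh c (ind K A) := by
  intro x y x' y' e
  simp only [ind, hA _ _ _ _ e]

theorem CC.deg_eq [Fintype ι] (h : CC c) {A : V → V → Prop} (hA : Coh c A) {x x' : V}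
    (e : c x x = c x' x') : deg A x = deg A x' := by
  have := h.coh_mul (coh_ind (K := ℕ) hA) (coh_ind (K := ℕ) coh_true) _ _ _ _ e
  simpa [Matrix.mul_apply, ind, deg] using this

/-- A coherent equivalence relation on the fiber of `o`. -/
structure Per (c : V → V → ι) (o : V) (E : V → V → Prop) : Prop where
  coh : Coh c E
  symm : ∀ {x y}, E x y → E y x
  trans : ∀ {x y z}, E x y → E y z → E x z
  refl_iff : ∀ {x}, E x x ↔ c x x = c o o

theorem Per.left {o : V} {E : V → V → Prop} (hE : Per c o E) {x y : V} (h : E x y) :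
    c x x = c o o := hE.refl_iff.1 (hE.trans h (hE.symm h))

theorem Per.right {o : V} {E : V → V → Prop} (hE : Per c o E) {x y : V} (h : E x y) :
    c y y = c o o := hE.left (hE.symm h)

theorem Per.o {o : V} {E : V → V → Prop} (hE : Per c o E) : E o o := hE.refl_iff.2 rfl

theorem Per.congr {o : V} {E : V → V → Prop} (hE : Per c o E) {x y : V} (h : E x y) :
    E x = E y := by
  ext z; exact ⟨fun k => hE.trans (hE.symm h) k, fun k => hE.trans h k⟩

/-- 2-power -/
def P2 (n : ℕ) : Prop := ∃ k : ℕ, n = 2 ^ k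

theorem P2.of_dvd {m n : ℕ} (h : P2 n) (d : m ∣ n) : P2 m := by
  obtain ⟨k, rfl⟩ := h
  obtain ⟨j, -, rfl⟩ := (Nat.dvd_prime_pow Nat.prime_two).1 d
  exact ⟨j, rfl⟩

theorem P2.mul {m n : ℕ} (h : P2 m) (h' : P2 n) : P2 (m * n) := by
  obtain ⟨k, rfl⟩ := h
  obtain ⟨j, rfl⟩ := h'
  exact ⟨k + j, by rw [pow_add]⟩

/-- The local 2-scheme property of `E`. -/
def Is2 (c : V → V → ι) (o : V) (E : V → V → Prop) : Prop :=
  P2 (deg E o) ∧ ∀ u v, E u v → P2 (deg (fun a b => c a b = c u v) u)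

/-- An index two step. -/
structure Step (c : V → V → ι) (o : V) (E F : V → V → Prop) : Prop where
  perE : Per c o E
  perF : Per c o F
  le : ∀ {x y}, E x y → F x y
  two : ∀ {u v w}, F u v → F u w → ¬ E u v → ¬ E u w → E v w
  ex : ∀ {u}, F u u → ∃ v, F u v ∧ ¬ E u v

theorem Step.deg_two [Fintype ι] (h : CC c) {o : V} {E F : V → V → Prop} (s : Step c o E F) :
    deg F o = 2 * deg E o := by
  obtain ⟨v, h1, h2⟩ := s.ex s.perF.o
  have h3 : deg E v = deg E o := h.deg_eq s.perE.coh (s.perF.right h1)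
  have h4 : (Finset.univ.filter fun y => F o y) =
      (Finset.univ.filter fun y => E o y) ∪ (Finset.univ.filter fun y => E v y) := by
    ext y
    simp only [Finset.mem_filter, Finset.mem_univ, true_and, Finset.mem_union]
    constructor
    · intro hy
      by_cases k : E o y
      · exact Or.inl k
      · exact Or.inr (s.two h1 hy h2 k)
    · rintro (k | k)
      · exact s.le k
      · exact s.perF.trans h1 (s.le k)
  rw [two_mul]
  nth_rw 2 [← h3]
  unfold deg
  rw [h4, Finset.card_union_of_disjoint]
  rw [Finset.disjoint_left]
  intro y hy hy'
  simp only [Finset.mem_filter, Finset.mem_univ, true_and] at hy hy'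
  exact h2 (s.perE.trans hy (s.perE.symm hy'))

/-- trivial equivalence on the fiber -/
def triv (c : V → V → ι) (o : V) : V → V → Prop := fun a b => a = b ∧ c a a = c o o

theorem CC.per_triv (h : CC c) (o : V) : Per c o (triv c o) where
  coh := by
    apply Coh.of_imp
    rintro u v u' v' e ⟨rfl, h2⟩
    obtain rfl := h.diag e rfl
    exact ⟨rfl, e ▸ h2⟩
  symm := by rintro x y ⟨rfl, h⟩; exact ⟨rfl, h⟩
  trans := by rintro x y z ⟨rfl, h⟩ ⟨rfl, _⟩; exact ⟨rfl, h⟩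
  refl_iff := by intro x; simp [triv]

theorem deg_triv (o : V) : deg (triv c o) o = 1 := by
  unfold deg triv
  rw [Finset.card_eq_one]
  exact ⟨o, by ext; simp [eq_comm]⟩

/-- full equivalence on the fiber -/
def full (c : V → V → ι) (o : V) : V → V → Prop := fun a b => c a a = c o o ∧ c b b = c o o

theorem CC.per_full (h : CC c) (o : V) : Per c o (full c o) where
  coh := by
    apply Coh.of_imp
    rintro u v u' v' e ⟨h1, h2⟩
    exact ⟨h.fib_left e ▸ h1, h.fib_right e ▸ h2⟩
  symm := by rintro x y ⟨h1, h⟩; exact ⟨h, h1⟩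
  trans := by rintro x y z ⟨h, _⟩ ⟨_, h'⟩; exact ⟨h, h'⟩
  refl_iff := by intro x; simp [full]

theorem deg_full (o : V) : deg (full c o) o = (Finset.univ.filter fun a => c a a = c o o).card := by
  simp [deg, full]

/-- colour classes have size `fiber * valency` -/
theorem CC.card_color [Fintype ι] (h : CC c) (u v : V) :
    (Finset.univ.filter fun p : V × V => c p.1 p.2 = c u v).card =
      (Finset.univ.filter fun a => c a a = c u u).card * deg (fun a b => c a b = c u v) u := by
  rw [Finset.card_eq_sum_card_fiberwise (f := Prod.fst)
    (t := (Finset.univ.filter fun a => c a a = c u u))]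
  · rw [Finset.sum_const_nat]
    intro a ha
    simp only [Finset.mem_filter, Finset.mem_univ, true_and] at ha
    rw [← h.deg_eq (coh_col _) ha]
    unfold deg
    refine Finset.card_bij' (fun p _ => p.2) (fun b _ => (a, b)) ?_ ?_ ?_ ?_
    · rintro ⟨p, q⟩ hp
      simp only [Finset.mem_filter, Finset.mem_univ, true_and] at hp ⊢
      rw [← hp.2]; exact hp.1
    · intro b hb
      simpa using hb
    · rintro ⟨p, q⟩ hp
      simp only [Finset.mem_filter, Finset.mem_univ, true_and] at hp ⊢
      rw [← hp.2]
    · intro b hb; rfl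
  · rintro ⟨p, q⟩ hp
    simp at hp ⊢
    exact h.fib_left hp

/-- Bipartite colouring from a tower step. -/
theorem Step.color {o : V} {E F : V → V → Prop} (s : Step c o E F) :
    ∃ g : V → ZMod 2, ∀ a b, F a b → ¬ E a b → g a ≠ g b := by
  have : Nonempty V := ⟨o⟩
  refine ⟨fun a => if E a (Classical.epsilon (F a)) then 1 else 0, ?_⟩
  intro a b hF hE
  simp only [← s.perF.congr hF]
  have hr : F a (Classical.epsilon (F a)) := Classical.epsilon_spec (p := F a) ⟨b, hF⟩
  set r := Classical.epsilon (F a)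
  by_cases h1 : E a r
  · by_cases h2 : E b r
    · exact absurd (s.perE.trans h1 (s.perE.symm h2)) hE
    · simp [h1, h2]
  · have h2 : E b r := s.two hF hr hE h1
    simp [h1, h2]

/-- Doubling. -/
theorem Step.double [Fintype ι] (h : CC c) {o : V} {E F : V → V → Prop} (s : Step c o E F) (r : ι) :
    deg (rc F (fun a b => c a b = r)) o = deg (rc E (fun a b => c a b = r)) o ∨
    deg (rc F (fun a b => c a b = r)) o = 2 * deg (rc E (fun a b => c a b = r)) o := by
  set R : V → V → Prop := fun a b => c a b = r with hR
  obtain ⟨x, h1, h2⟩ := s.ex s.perF.o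
  have h3 : deg (rc E R) x = deg (rc E R) o :=
    h.deg_eq (h.coh_rc s.perE.coh (coh_col r)) (s.perF.right h1)
  have h4 : (Finset.univ.filter fun y => rc F R o y) =
      (Finset.univ.filter fun y => rc E R o y) ∪ (Finset.univ.filter fun y => rc E R x y) := by
    ext y
    simp only [Finset.mem_filter, Finset.mem_univ, true_and, Finset.mem_union]
    constructor
    · rintro ⟨w, hw, hy⟩
      by_cases k : E o w
      · exact Or.inl ⟨w, k, hy⟩
      · exact Or.inr ⟨w, s.two h1 hw h2 k, hy⟩
    · rintro (⟨w, k, hy⟩ | ⟨w, k, hy⟩)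
      · exact ⟨w, s.le k, hy⟩
      · exact ⟨w, s.perF.trans h1 (s.le k), hy⟩
  by_cases hd : Disjoint (Finset.univ.filter fun y => rc E R o y) (Finset.univ.filter fun y => rc E R x y)
  · right
    rw [two_mul]
    nth_rw 2 [← h3]
    unfold deg
    rw [h4, Finset.card_union_of_disjoint hd]
  · left
    rw [Finset.not_disjoint_iff] at hd
    obtain ⟨y, hy1, hy2⟩ := hd
    simp only [Finset.mem_filter, Finset.mem_univ, true_and] at hy1 hy2
    obtain ⟨a, ha, ha'⟩ := hy1
    obtain ⟨b, hb, hb'⟩ := hy2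
    set D : V → V → Prop := fun p q => F p q ∧ ¬ E p q with hD
    have hDc : Coh c D := by
      intro p q p' q' e
      simp only [hD, s.perE.coh _ _ _ _ e, s.perF.coh _ _ _ _ e]
    have hDR : Coh c (rc D R) := h.coh_rc hDc (coh_col r)
    have hab : D a b := by
      refine ⟨s.perF.trans (s.perF.symm (s.le ha)) (s.perF.trans h1 (s.le hb)), fun k => h2 ?_⟩
      exact s.perE.trans ha (s.perE.trans k (s.perE.symm hb))
    have key : rc D R a y := ⟨b, hab, hb'⟩
    unfold deg
    rw [h4, Finset.union_eq_left.2]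
    intro v hv
    simp only [Finset.mem_filter, Finset.mem_univ, true_and] at hv ⊢
    obtain ⟨b', k1, k2⟩ := hv
    obtain ⟨b'', ⟨k3, k4⟩, k5⟩ := hDR.imp (show c a y = c b' v from (ha'.trans k2.symm)) key
    refine ⟨b'', ?_, k5⟩
    have hob : F o b' := s.perF.trans h1 (s.le k1)
    have hob' : ¬ E o b' := fun k => h2 (s.perE.trans k (s.perE.symm k1))
    exact s.two (s.perF.symm hob) k3 (fun k => hob' (s.perE.symm k)) k4

/-- double coset of a colour -/
def dc (c : V → V → ι) (E : V → V → Prop) (r : ι) : V → V → Prop :=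
  rc (rc E (fun a b => c a b = r)) E

theorem dc_intro {E : V → V → Prop} {r : ι} {a p q b : V} (h1 : E a p) (h2 : c p q = r)
    (h3 : E q b) : dc c E r a b := ⟨q, ⟨p, h1, h2⟩, h3⟩

theorem CC.coh_dc (h : CC c) {o : V} {E : V → V → Prop} (hE : Per c o E) (r : ι) :
    Coh c (dc c E r) := h.coh_rc (h.coh_rc hE.coh (coh_col r)) hE.coh

theorem dc_ext {o : V} {E : V → V → Prop} (hE : Per c o E) {r : ι} {a p q b : V}
    (h1 : E a p) (h2 : dc c E r p q) (h3 : E q b) : dc c E r a b := by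
  obtain ⟨y, ⟨x, h4, h5⟩, h6⟩ := h2
  exact dc_intro (hE.trans h1 h4) h5 (hE.trans h6 h3)

theorem CC.dc_eq (h : CC c) {o : V} {E : V → V → Prop} (hE : Per c o E) {s : ι} {u v : V}
    (hd : dc c E s u v) : dc c E (c u v) = dc c E s := by
  ext a b
  constructor
  · rintro ⟨q, ⟨p, h1, h2⟩, h3⟩
    exact dc_ext hE h1 ((h.coh_dc hE s).imp h2.symm hd) h3
  · rintro ⟨q, ⟨p, h1, h2⟩, h3⟩
    obtain ⟨y, ⟨x, h4, h5⟩, h6⟩ := hd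
    have : dc c E (c u v) x y := dc_intro (hE.symm h4) rfl (hE.symm h6)
    exact dc_ext hE h1 ((h.coh_dc hE _).imp (h5.trans h2.symm) this) h3

theorem rowsum_mul {A B : Matrix V V ℕ} {x : V} {β : ℕ}
    (hB : ∀ w, A x w ≠ 0 → ∑ v, B w v = β) : ∑ v, (A * B) x v = (∑ w, A x w) * β := by
  simp only [Matrix.mul_apply]
  rw [Finset.sum_comm, Finset.sum_mul]
  apply Finset.sum_congr rfl
  intro w _
  rw [← Finset.mul_sum]
  by_cases k : A x w = 0
  · simp [k]
  · rw [hB w k]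

theorem rowsum_ind (A : V → V → Prop) (x : V) : ∑ v, ind ℕ A x v = deg A x := by
  simp [ind, deg]

theorem CC.deg_dc_dvd [Fintype ι] (h : CC c) {o : V} {E : V → V → Prop} (hE : Per c o E) {u v : V}
    (hu : c u u = c o o) (hv : c v v = c o o) :
    deg (dc c E (c u v)) o ∣ deg E o * deg (fun a b => c a b = c u v) u * deg E o := by
  set R : V → V → Prop := fun a b => c a b = c u v with hR
  set N : Matrix V V ℕ := ind ℕ E * ind ℕ R * ind ℕ E with hN
  have hNc : Coh c N :=
    h.coh_mul (h.coh_mul (coh_ind hE.coh) (coh_ind (coh_col _))) (coh_ind hE.coh)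
  have key : ∀ a b, N a b = if dc c E (c u v) a b then N u v else 0 := by
    intro a b
    split_ifs with hd
    · obtain ⟨q, ⟨p, h1, h2⟩, h3⟩ := hd
      rw [← hNc _ _ _ _ h2]
      have e1 : ∀ w, ind ℕ E a w = ind ℕ E p w := by
        intro w; simp only [ind, hE.congr h1]
      have e2 : ∀ w, ind ℕ E w b = ind ℕ E w q := by
        intro w
        have : E w b ↔ E w q :=
          ⟨fun k => hE.trans k (hE.symm h3), fun k => hE.trans k h3⟩
        simp only [ind, this]
      simp only [hN, Matrix.mul_apply, e1, e2]
    · by_contra hne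
      obtain ⟨q, -, hq⟩ := Finset.exists_ne_zero_of_sum_ne_zero hne
      obtain ⟨hq1, hq2⟩ := mul_ne_zero_iff.1 hq
      obtain ⟨p, -, hp⟩ := Finset.exists_ne_zero_of_sum_ne_zero hq1
      obtain ⟨hp1, hp2⟩ := mul_ne_zero_iff.1 hp
      simp only [ind, ne_eq, ite_eq_right_iff, one_ne_zero, imp_false, not_not] at hq2 hp1 hp2
      exact hd (dc_intro hp1 hp2 hq2)
  have s1 : ∑ b, N o b = deg (dc c E (c u v)) o * N u v := by
    rw [Finset.sum_congr rfl fun b _ => key o b]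
    rw [← Finset.sum_filter, Finset.sum_const, smul_eq_mul]
    rfl
  have s2 : ∑ b, N o b = deg E o * deg R u * deg E o := by
    rw [hN, rowsum_mul (β := deg E o), rowsum_mul (β := deg R u), rowsum_ind]
    · intro w hw
      simp only [ind, ne_eq, ite_eq_right_iff, one_ne_zero, imp_false, not_not] at hw
      rw [rowsum_ind]
      exact h.deg_eq (coh_col _) ((hE.right hw).trans hu.symm)
    · intro w hw
      obtain ⟨p, -, hp⟩ := Finset.exists_ne_zero_of_sum_ne_zero hw
      obtain ⟨hp1, hp2⟩ := mul_ne_zero_iff.1 hp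
      simp only [ind, ne_eq, ite_eq_right_iff, one_ne_zero, imp_false, not_not] at hp2
      rw [rowsum_ind]
      exact h.deg_eq hE.coh ((h.fib_right hp2).trans hv)
  rw [← s2, s1]
  exact dvd_mul_right _ _

theorem CC.deg_swap [Fintype ι] (h : CC c) {o : V} {A : V → V → Prop} (hA : Coh c A)
    (hX : ∀ a b, A a b → c a a = c o o ∧ c b b = c o o) :
    deg (fun a b => A b a) o = deg A o := by
  have key : ∀ B : V → V → Prop, Coh c B → (∀ a b, B a b → c a a = c o o ∧ c b b = c o o) →
      ∑ a, ∑ b, ind ℕ B a b = (Finset.univ.filter fun a => c a a = c o o).card * deg B o := by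
    intro B hB hX
    simp only [rowsum_ind]
    rw [← Finset.sum_filter_add_sum_filter_not Finset.univ (fun a => c a a = c o o)]
    rw [Finset.sum_const_nat (m := deg B o), Finset.sum_eq_zero, add_zero]
    · intro x hx
      simp only [Finset.mem_filter, Finset.mem_univ, true_and] at hx
      simp only [deg, Finset.card_eq_zero, Finset.filter_eq_empty_iff]
      intro y _ hy
      exact hx (hX _ _ hy).1
    · intro x hx
      simp only [Finset.mem_filter, Finset.mem_univ, true_and] at hx
      exact h.deg_eq hB hx
  have k1 := key A hA hX
  have k2 := key _ (h.coh_swap hA) (fun a b k => (hX _ _ k).symm)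
  have k3 : ∑ a, ∑ b, ind ℕ (fun a b => A b a) a b = ∑ a, ∑ b, ind ℕ A a b := Finset.sum_comm
  have : (Finset.univ.filter fun a => c a a = c o o).card * deg (fun a b => A b a) o =
      (Finset.univ.filter fun a => c a a = c o o).card * deg A o := by
    rw [← k1, ← k2, k3]
  exact Nat.eq_of_mul_eq_mul_left (Finset.card_pos.2 ⟨o, by simp⟩) this

theorem P2.two_mul_dvd {a b : ℕ} (ha : P2 a) (hb : P2 b) (hab : a < b) : 2 * a ∣ b := by
  obtain ⟨k, rfl⟩ := ha
  obtain ⟨j, rfl⟩ := hb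
  have : k < j := (Nat.pow_lt_pow_iff_right (by norm_num)).1 hab
  rw [← pow_succ']
  exact pow_dvd_pow _ this

theorem CC.exists_step [Fintype ι] (h : CC c) {o : V} {E₀ E : V → V → Prop} (h0 : Per c o E₀)
    (hE : Per c o E) (le : ∀ x y, E x y → E₀ x y) (is2 : Is2 c o E₀) (hp : P2 (deg E o))
    (lt : deg E o < deg E₀ o) : ∃ F, Step c o E F ∧ ∀ x y, F x y → E₀ x y := by
  have sub : ∀ y, E₀ o y → ∀ a b, dc c E (c o y) a b → E₀ a b := by
    rintro y hy a b ⟨q, ⟨p, h1, h2⟩, h3⟩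
    exact h0.trans (le _ _ h1) (h0.trans (h0.coh.imp h2.symm hy) (le _ _ h3))
  have self : ∀ y, E₀ o y → dc c E (c o y) o y := fun y hy =>
    dc_intro hE.o rfl (hE.refl_iff.2 (h0.right hy))
  have hEo : dc c E (c o o) = E := by
    ext a b
    constructor
    · rintro ⟨q, ⟨p, h1, h2⟩, h3⟩
      obtain rfl := h.diag h2.symm rfl
      exact hE.trans h1 h3
    · intro k
      exact dc_intro k (hE.right k) (hE.refl_iff.2 (hE.right k))
  have p2 : ∀ y, E₀ o y → P2 (deg (dc c E (c o y)) o) := fun y hy =>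
    ((hp.mul (is2.2 _ _ hy)).mul hp).of_dvd (h.deg_dc_dvd hE rfl (h0.right hy))
  have ge : ∀ y, E₀ o y → deg E o ≤ deg (dc c E (c o y)) o := by
    intro y hy
    rw [← h.deg_eq hE.coh (h0.right hy)]
    apply Finset.card_le_card
    intro z hz
    simp only [Finset.mem_filter, Finset.mem_univ, true_and] at hz ⊢
    exact dc_intro hE.o rfl hz
  set 𝒟 : Finset (V → V → Prop) := (Finset.univ.filter fun y => E₀ o y).image (fun y => dc c E (c o y))
    with h𝒟
  have sum : deg E₀ o = ∑ D ∈ 𝒟, deg D o := by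
    unfold deg
    rw [Finset.card_eq_sum_card_image (fun y => dc c E (c o y))]
    apply Finset.sum_congr rfl
    intro D hD
    simp only [h𝒟, Finset.mem_image, Finset.mem_filter, Finset.mem_univ, true_and] at hD
    obtain ⟨y, hy, rfl⟩ := hD
    congr 1
    ext z
    simp only [Finset.mem_filter, Finset.mem_univ, true_and]
    constructor
    · rintro ⟨h1, h2⟩
      rw [← h2]
      exact self z h1
    · intro k
      exact ⟨sub y hy _ _ k, h.dc_eq hE k⟩
  set 𝒟₁ := 𝒟.filter (fun D => deg D o = deg E o) with h𝒟₁
  have epos : 0 < deg E o := Finset.card_pos.2 ⟨o, by simpa using hE.o⟩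
  have even : 2 ∣ 𝒟₁.card := by
    rw [← Finset.sum_filter_add_sum_filter_not 𝒟 (fun D => deg D o = deg E o)] at sum
    rw [Finset.sum_const_nat (m := deg E o) (by intro x hx; exact (Finset.mem_filter.1 hx).2)] at sum
    have d1 : 2 * deg E o ∣ ∑ D ∈ 𝒟 with ¬ deg D o = deg E o, deg D o := by
      apply Finset.dvd_sum
      intro D hD
      rw [Finset.mem_filter] at hD
      obtain ⟨hD, hne⟩ := hD
      simp only [h𝒟, Finset.mem_image, Finset.mem_filter, Finset.mem_univ, true_and] at hD
      obtain ⟨y, hy, rfl⟩ := hD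
      exact hp.two_mul_dvd (p2 y hy) (lt_of_le_of_ne (ge y hy) (Ne.symm hne))
    have d2 : 2 * deg E o ∣ deg E₀ o := hp.two_mul_dvd is2.1 lt
    rw [sum] at d2
    have d3 := (Nat.dvd_add_left d1).1 d2
    exact Nat.dvd_of_mul_dvd_mul_right epos d3
  have hsw : ∀ D ∈ 𝒟₁, (fun a b => D b a) ∈ 𝒟₁ := by
    intro D hD
    rw [h𝒟₁, Finset.mem_filter] at hD ⊢
    obtain ⟨hD, hd⟩ := hD
    simp only [h𝒟, Finset.mem_image, Finset.mem_filter, Finset.mem_univ, true_and] at hD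
    obtain ⟨y, hy, rfl⟩ := hD
    have hdeg : deg (fun a b => dc c E (c o y) b a) o = deg E o := by
      rw [← hd]
      exact h.deg_swap (h.coh_dc hE _)
        (fun a b k => ⟨h0.left (sub y hy _ _ k), h0.right (sub y hy _ _ k)⟩)
    refine ⟨?_, hdeg⟩
    have hpos : 0 < deg (fun a b => dc c E (c o y) b a) o := hdeg ▸ epos
    obtain ⟨z, hz⟩ := Finset.card_pos.1 hpos
    simp only [Finset.mem_filter, Finset.mem_univ, true_and] at hz
    simp only [h𝒟, Finset.mem_image, Finset.mem_filter, Finset.mem_univ, true_and]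
    refine ⟨z, h0.symm (sub y hy _ _ hz), ?_⟩
    rw [← h.dc_eq hE hz]
    ext a b
    constructor
    · rintro ⟨q, ⟨p, h1, h2⟩, h3⟩
      exact dc_intro (hE.symm h3) (h.symm h2) (hE.symm h1)
    · rintro ⟨q, ⟨p, h1, h2⟩, h3⟩
      exact dc_intro (hE.symm h3) (h.symm h2) (hE.symm h1)
  have hE1 : E ∈ 𝒟₁ := by
    simp only [h𝒟₁, h𝒟, Finset.mem_image, Finset.mem_filter, Finset.mem_univ, true_and, and_true]
    exact ⟨o, h0.o, hEo⟩
  let σ : Equiv.Perm 𝒟₁ :=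
    ⟨fun D => ⟨fun a b => D.1 b a, hsw D.1 D.2⟩, fun D => ⟨fun a b => D.1 b a, hsw D.1 D.2⟩,
      fun D => rfl, fun D => rfl⟩
  have hσ : σ ^ 2 ^ 1 = 1 := by
    ext D : 1
    rfl
  have fact2 : Fact (Nat.Prime 2) := ⟨Nat.prime_two⟩
  obtain ⟨⟨D, hD1⟩, hfix, hne⟩ := Equiv.Perm.exists_fixed_point_of_prime' (p := 2) (n := 1)
    (by simpa using even) hσ (a := ⟨E, hE1⟩)
    (by apply Subtype.ext; ext a b; exact ⟨hE.symm, hE.symm⟩)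
  have hDE : D ≠ E := fun k => hne (Subtype.ext k)
  have hDs : ∀ {a b}, D a b → D b a := by
    intro a b k
    have := congrArg Subtype.val hfix
    have := congrFun (congrFun this b) a
    exact this.mp k
  clear hne hfix
  rw [h𝒟₁, Finset.mem_filter] at hD1
  obtain ⟨hD, hd⟩ := hD1
  simp only [h𝒟, Finset.mem_image, Finset.mem_filter, Finset.mem_univ, true_and] at hD
  obtain ⟨y, hy, hDy⟩ := hD
  have Dsub : ∀ {a b}, D a b → E₀ a b := by
    intro a b k; rw [← hDy] at k; exact sub y hy _ _ k
  have Dext : ∀ {a p q b}, E a p → D p q → E q b → D a b := by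
    intro a p q b h1 h2 h3
    rw [← hDy] at h2 ⊢
    exact dc_ext hE h1 h2 h3
  have Dcoh : Coh c D := hDy ▸ h.coh_dc hE _
  have Ddisj : ∀ {a b}, D a b → ¬ E a b := by
    intro a b k k'
    rw [← hDy] at k
    replace k' : dc c E (c o o) a b := by rw [hEo]; exact k'
    exact hDE (hDy.symm.trans ((h.dc_eq hE k).symm.trans ((h.dc_eq hE k').trans hEo)))
  have erefl : ∀ {a b}, D a b → E a a ∧ E b b := fun k =>
    ⟨hE.refl_iff.2 (h0.left (Dsub k)), hE.refl_iff.2 (h0.right (Dsub k))⟩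
  have DD : ∀ {v u w}, D v u → D v w → E u w := by
    intro v u w h1 h2
    have hv : deg D v = deg E o := by
      rw [← hd]; exact h.deg_eq Dcoh (h0.left (Dsub h1))
    have hw : deg E w = deg E o := h.deg_eq hE.coh (h0.right (Dsub h2))
    have hs : (Finset.univ.filter fun z => E w z) ⊆ (Finset.univ.filter fun z => D v z) := by
      intro z hz
      simp only [Finset.mem_filter, Finset.mem_univ, true_and] at hz ⊢
      exact Dext (erefl h2).1 h2 hz
    have heq := Finset.eq_of_subset_of_card_le hs (le_of_eq (hv.trans hw.symm))
    have : u ∈ (Finset.univ.filter fun z => D v z) := by simpa using h1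
    rw [← heq] at this
    exact hE.symm (by simpa using this)
  refine ⟨fun a b => E a b ∨ D a b, ⟨hE, ⟨?_, ?_, ?_, ?_⟩, Or.inl, ?_, ?_⟩, ?_⟩
  · intro a b a' b' e
    simp only [hE.coh _ _ _ _ e, Dcoh _ _ _ _ e]
  · rintro a b (k | k)
    · exact Or.inl (hE.symm k)
    · exact Or.inr (hDs k)
  · rintro a b d (k | k) (k' | k')
    · exact Or.inl (hE.trans k k')
    · exact Or.inr (Dext k k' (erefl k').2)
    · exact Or.inr (Dext (erefl k).1 k k')
    · exact Or.inl (DD (hDs k) k')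
  · intro x
    rw [hE.refl_iff]
    exact ⟨fun k => k.elim id fun k => h0.left (Dsub k), Or.inl⟩
  · rintro u v w (h1 | h1) (h2 | h2) h3 h4
    · exact absurd h1 h3
    · exact absurd h1 h3
    · exact absurd h2 h4
    · exact DD h1 h2
  · intro u hu
    have hu : c u u = c o o := hu.elim hE.left fun k => h0.left (Dsub k)
    have hpos : 0 < deg D u := by
      rw [h.deg_eq Dcoh hu, hd]; exact epos
    obtain ⟨z, hz⟩ := Finset.card_pos.1 hpos
    simp only [Finset.mem_filter, Finset.mem_univ, true_and] at hz
    exact ⟨z, Or.inr hz, Ddisj hz⟩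
  · rintro x y (k | k)
    · exact le _ _ k
    · exact Dsub k

theorem CC.tower [Fintype ι] (h : CC c) {o : V} {E₀ : V → V → Prop} (h0 : Per c o E₀)
    (is2 : Is2 c o E₀) (P : (V → V → Prop) → Prop) (base : P (triv c o))
    (st : ∀ E F, Step c o E F → P E → P F) : P E₀ := by
  have key : ∀ n, ∀ E, Per c o E → (∀ x y, E x y → E₀ x y) → P2 (deg E o) → P E →
      deg E₀ o - deg E o ≤ n → P E₀ := by
    intro n
    induction n with
    | zero =>
      intro E hE le hp hP hn
      have : E = E₀ := by
        ext x y
        refine ⟨le x y, fun k => ?_⟩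
        have hs : (Finset.univ.filter fun z => E x z) ⊆ (Finset.univ.filter fun z => E₀ x z) := by
          intro z hz
          simp only [Finset.mem_filter, Finset.mem_univ, true_and] at hz ⊢
          exact le _ _ hz
        have hc : deg E₀ x ≤ deg E x := by
          rw [h.deg_eq hE.coh (h0.left k), h.deg_eq h0.coh (h0.left k)]
          omega
        have heq := Finset.eq_of_subset_of_card_le hs hc
        have : y ∈ (Finset.univ.filter fun z => E₀ x z) := by simpa using k
        rw [← heq] at this
        simpa using this
      exact this ▸ hP
    | succ n ih =>
      intro E hE le hp hP hn
      by_cases lt : deg E o < deg E₀ o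
      · obtain ⟨F, hF, hle⟩ := h.exists_step h0 hE le is2 hp lt
        have hd := hF.deg_two h
        have epos : 0 < deg E o := Finset.card_pos.2 ⟨o, by simpa using hE.o⟩
        exact ih F hF.perF hle (hd ▸ (P2.mul ⟨1, rfl⟩ hp)) (st _ _ hF hP) (by omega)
      · exact ih E hE le hp hP (by omega)
  refine key _ _ (h.per_triv o) ?_ ⟨0, deg_triv o⟩ base le_rfl
  rintro x y ⟨rfl, k⟩
  exact h0.refl_iff.2 k

theorem CC.tower_double [Fintype ι] (h : CC c) {o : V} {E₀ : V → V → Prop} (h0 : Per c o E₀)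
    (is2 : Is2 c o E₀) (r : ι) :
    deg (fun a b => c a b = r) o ∣ deg (rc E₀ (fun a b => c a b = r)) o := by
  refine h.tower h0 is2 (fun E => deg (fun a b => c a b = r) o ∣
    deg (rc E (fun a b => c a b = r)) o) ?_ ?_
  · apply dvd_of_eq
    unfold deg
    congr 1
    ext y
    simp [rc, triv]
  · intro E F s hd
    rcases s.double h r with k | k
    · exact k ▸ hd
    · exact k ▸ (dvd_mul_of_dvd_right hd 2)

theorem CC.tower_color [Fintype ι] (h : CC c) {o : V} {E₀ : V → V → Prop} (h0 : Per c o E₀)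
    (is2 : Is2 c o E₀) : ∀ u v, E₀ u v → u ≠ v →
      ∃ g : V → ZMod 2, ∀ a b, c a b = c u v → g a ≠ g b := by
  refine h.tower h0 is2 (fun E => ∀ u v, E u v → u ≠ v →
      ∃ g : V → ZMod 2, ∀ a b, c a b = c u v → g a ≠ g b) ?_ ?_
  · rintro u v ⟨rfl, -⟩ k
    exact absurd rfl k
  · intro E F s hP u v hF hne
    by_cases hE : E u v
    · exact hP u v hE hne
    · obtain ⟨g, hg⟩ := s.color
      refine ⟨g, fun a b e => hg a b (s.perF.coh.imp e.symm hF) fun k => hE ?_⟩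
      exact s.perE.coh.imp e k

theorem sum_ofFn_prod [Fintype ι] {K : Type*} [Semiring K] (B : ι → K) (n : ℕ) :
    ∑ f : Fin n → ι, (List.ofFn (fun i => B (f i))).prod = (∑ r, B r) ^ n := by
  induction n with
  | zero => simp
  | succ n ih =>
    rw [pow_succ', ← ih, Finset.sum_mul_sum, ← Fintype.sum_prod_type' (fun r (f : Fin n → ι) =>
        B r * (List.ofFn (fun i => B (f i))).prod)]
    symm
    apply Fintype.sum_equiv (Fin.consEquiv (fun _ => ι))
    rintro ⟨r, f⟩
    simp [List.ofFn_succ, Fin.consEquiv]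

/-- A rotation invariant function on tuples vanishing on constants has sum divisible by `q`. -/
theorem dvd_sum_rot [Fintype ι] {n : ℕ} (hq : (n + 1).Prime) (W : (Fin (n + 1) → ι) → ℕ)
    (rot : ∀ f, W (fun i => f (i + 1)) = W f) (cst : ∀ r, W (fun _ => r) = 0) :
    n + 1 ∣ ∑ f, W f := by
  let α := {a : (Fin (n + 1) → ι) × Fin ((∑ f, W f) + 1) // a.2.1 < W a.1}
  let σ : Function.End α := fun a => ⟨(fun i => a.1.1 (i + 1), a.1.2), by
    have := a.2
    rw [← rot] at this
    exact this⟩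
  have hpow : ∀ k : ℕ, ∀ a : α, ((σ ^ k) a).1.2 = a.1.2 ∧
      ∀ i, ((σ ^ k) a).1.1 i = a.1.1 ((fun j => j + 1)^[k] i) := by
    intro k
    induction k with
    | zero =>
      intro a
      exact ⟨rfl, fun i => rfl⟩
    | succ k ih =>
      intro a
      rw [pow_succ']
      change (σ ((σ ^ k) a)).1.2 = _ ∧ ∀ i, (σ ((σ ^ k) a)).1.1 i = _
      refine ⟨(ih a).1, fun i => ?_⟩
      rw [Function.iterate_succ_apply]
      exact (ih a).2 (i + 1)
  have hit : ∀ k : ℕ, ∀ i : Fin (n + 1), ((fun j => j + 1)^[k] i).val = (i.val + k) % (n + 1) := by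
    intro k
    induction k with
    | zero => intro i; simp [Nat.mod_eq_of_lt i.2]
    | succ k ih =>
      intro i
      rw [Function.iterate_succ_apply', Fin.val_add, ih]
      simp only [Fin.val_one', Nat.add_mod_mod, Nat.mod_add_mod, add_assoc]
  have h1 : σ ^ (n + 1) ^ 1 = 1 := by
    funext a
    rw [pow_one]
    apply Subtype.ext
    refine Prod.ext ?_ (hpow _ a).1
    funext i
    rw [(hpow _ a).2]
    have : (fun j => j + 1)^[n + 1] i = i := by
      apply Fin.ext
      rw [hit]
      simp [Nat.mod_eq_of_lt i.2]
    rw [this]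
    rfl
  have fact : Fact (n + 1).Prime := ⟨hq⟩
  have h2 := Equiv.Perm.card_fixedPoints_modEq (p := n + 1) (n := 1) h1
  have h3 : IsEmpty (Function.fixedPoints σ) := by
    constructor
    rintro ⟨⟨⟨f, k⟩, hk⟩, hf⟩
    have h4 : ∀ i, f (i + 1) = f i := by
      intro i
      have := congrArg (fun a : α => a.1.1) hf
      exact congrFun this i
    have h5 : ∀ i, f i = f 0 := by
      intro i
      induction i using Fin.induction with
      | zero => rfl
      | succ i ih => rw [← ih, ← h4 i.castSucc, Fin.coeSucc_eq_succ]
    have h6 : f = fun _ => f 0 := funext h5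
    have : W f = 0 := by rw [h6]; exact cst _
    simp only [this] at hk
    omega
  rw [Fintype.card_eq_zero (α := Function.fixedPoints σ)] at h2
  have h7 : Fintype.card α = ∑ f, W f := by
    have e : ∀ f, W f = (Finset.univ.filter fun k : Fin ((∑ f, W f) + 1) => k.1 < W f).card := by
      intro f
      have hle : W f ≤ ∑ f, W f := Finset.single_le_sum (fun _ _ => Nat.zero_le _) (Finset.mem_univ f)
      rw [Fin.card_filter_val_lt]
      omega
    rw [Fintype.card_subtype]
    conv_rhs => rw [Finset.sum_congr rfl fun f _ => e f]
    rw [Finset.card_eq_sum_card_fiberwise (f := Prod.fst) (t := Finset.univ) (by simp)]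
    apply Finset.sum_congr rfl
    intro f _
    refine Finset.card_bij' (fun p _ => p.2) (fun k _ => (f, k)) ?_ ?_ ?_ ?_
    · rintro ⟨p, q⟩ hp
      simp only [Finset.mem_filter, Finset.mem_univ, true_and] at hp ⊢
      rw [← hp.2]; exact hp.1
    · intro b hb
      simpa using hb
    · rintro ⟨p, q⟩ hp
      simp only [Finset.mem_filter, Finset.mem_univ, true_and] at hp ⊢
      rw [← hp.2]
    · intro b hb; rfl
  rw [← h7]
  exact (Nat.modEq_zero_iff_dvd).1 h2

theorem CC.frob [Fintype ι] (h : CC c) {o : V} {E : V → V → Prop} (hE : Per c o E)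
    (bip : ∀ u v, u ≠ v → ∃ g : V → ZMod 2, ∀ a b, c a b = c u v → g a ≠ g b) :
    P2 (deg E o) := by
  have epos : 0 < deg E o := Finset.card_pos.2 ⟨o, by simpa using hE.o⟩
  refine ⟨_, Nat.eq_prime_pow_of_unique_prime_dvd (p := 2) epos.ne' ?_⟩
  intro q hq hqd
  by_contra hq2
  have hodd : Odd q := hq.odd_of_ne_two hq2
  set B : ι → Matrix V V ℕ := fun r => ind ℕ (fun a b => c a b = r ∧ E a b ∧ a ≠ b) with hB
  have hBc : ∀ r, Coh c (B r) := by
    intro r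
    apply coh_ind
    apply Coh.of_imp
    rintro x y x' y' e ⟨h1, h2, h3⟩
    exact ⟨e ▸ h1, hE.coh.imp e h2, fun k => h3 (h.diag e.symm k)⟩
  obtain ⟨n, rfl⟩ : ∃ n, q = n + 1 := ⟨q - 1, by have := hq.pos; omega⟩
  set Pr : (Fin (n + 1) → ι) → Matrix V V ℕ := fun f => (List.ofFn (fun i => B (f i))).prod with hPr
  have hone : Coh c (1 : Matrix V V ℕ) := by
    intro x y x' y' e
    have : x = y ↔ x' = y' := ⟨h.diag e, h.diag e.symm⟩
    simp [Matrix.one_apply, this]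
  have hlist : ∀ l : List (Matrix V V ℕ), (∀ M ∈ l, Coh c M) → Coh c l.prod := by
    intro l
    induction l with
    | nil => intro _; simpa using hone
    | cons M l ih =>
      intro hl
      rw [List.prod_cons]
      exact h.coh_mul (hl M (by simp)) (ih fun N hN => hl N (by simp [hN]))
  have hPc : ∀ f, Coh c (Pr f) := by
    intro f
    apply hlist
    intro M hM
    rw [List.mem_ofFn] at hM
    obtain ⟨i, rfl⟩ := hM
    exact hBc _
  have htr : ∀ f, (Pr f).trace = (Finset.univ.filter fun a => c a a = c o o).card * Pr f o o := by
    intro f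
    rw [Matrix.trace, ← Finset.sum_filter_add_sum_filter_not Finset.univ (fun a => c a a = c o o)]
    rw [Finset.sum_const_nat (m := Pr f o o), Finset.sum_eq_zero, add_zero]
    · intro x hx
      simp only [Finset.mem_filter, Finset.mem_univ, true_and] at hx
      simp only [Matrix.diag, hPr, List.ofFn_succ, List.prod_cons, Matrix.mul_apply]
      apply Finset.sum_eq_zero
      intro w _
      have : B (f 0) x w = 0 := by
        simp only [hB, ind]
        rw [if_neg]
        rintro ⟨-, k, -⟩
        exact hx (hE.left k)
      rw [this, zero_mul]
    · intro x hx
      simp only [Finset.mem_filter, Finset.mem_univ, true_and] at hx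
      exact hPc f _ _ _ _ hx
  have hXpos : 0 < (Finset.univ.filter fun a => c a a = c o o).card := Finset.card_pos.2 ⟨o, by simp⟩
  have rot : ∀ f, Pr (fun i => f (i + 1)) o o = Pr f o o := by
    intro f
    apply Nat.eq_of_mul_eq_mul_left hXpos
    rw [← htr, ← htr]
    simp only [hPr]
    rw [List.ofFn_succ_last, List.prod_append, List.ofFn_succ, List.prod_cons, Matrix.trace_mul_comm]
    simp
  have cst : ∀ r, Pr (fun _ => r) o o = 0 := by
    intro r
    simp only [hPr, List.ofFn_const, List.prod_replicate]
    by_contra hne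
    have hr : ∃ u v, u ≠ v ∧ c u v = r := by
      by_contra hno
      push Not at hno
      have : B r = 0 := by
        ext a b
        simp only [hB, ind, Matrix.zero_apply]
        rw [if_neg]
        rintro ⟨k1, -, k2⟩
        exact hno a b k2 k1
      rw [this, zero_pow (by omega)] at hne
      exact hne rfl
    obtain ⟨u, v, huv, rfl⟩ := hr
    obtain ⟨g, hg⟩ := bip u v huv
    have key : ∀ k : ℕ, ∀ x y, ((B (c u v)) ^ k) x y ≠ 0 → g y = g x + k := by
      intro k
      induction k with
      | zero =>
        intro x y hxy
        by_cases e : x = y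
        · simp [e]
        · simp [Matrix.one_apply, e] at hxy
      | succ k ih =>
        intro x y hxy
        rw [pow_succ, Matrix.mul_apply] at hxy
        obtain ⟨w, -, hw⟩ := Finset.exists_ne_zero_of_sum_ne_zero hxy
        obtain ⟨h1, h2⟩ := mul_ne_zero_iff.1 hw
        have h3 := ih _ _ h1
        simp only [hB, ind, ne_eq, ite_eq_right_iff, one_ne_zero, imp_false, not_not] at h2
        have h4 := hg _ _ h2.1
        have h5 : ∀ a b : ZMod 2, a ≠ b → b = a + 1 := by decide
        rw [h5 _ _ h4, h3]
        push_cast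
        ring
    have h6 := key _ _ _ hne
    have h7 : ((n + 1 : ℕ) : ZMod 2) = 1 := ZMod.natCast_eq_one_iff_odd.2 hodd
    rw [h7] at h6
    have h8 : ∀ a : ZMod 2, a ≠ a + 1 := by decide
    exact h8 _ h6
  have hdvd := dvd_sum_rot hq (fun f => Pr f o o) rot cst
  have hsum : ∑ f, Pr f o o = ((∑ r, B r) ^ (n + 1)) o o := by
    rw [← sum_ofFn_prod, Matrix.sum_apply]
  rw [hsum] at hdvd
  have fact : Fact (n + 1).Prime := ⟨hq⟩
  have hcast : (((∑ r, B r) ^ (n + 1)) o o : ZMod (n + 1)) = 0 :=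
    (ZMod.natCast_eq_zero_iff _ _).2 hdvd
  -- evaluate
  set J : Matrix V V (ZMod (n + 1)) := ind _ E with hJ
  set D : Matrix V V (ZMod (n + 1)) := ind _ (triv c o) with hD
  have hM : (∑ r, B r).map (Nat.castRingHom (ZMod (n + 1))) = J - D := by
    ext a b
    have e1 : (∑ r, B r) a b = if E a b ∧ a ≠ b then 1 else 0 := by
      rw [Matrix.sum_apply, Finset.sum_eq_single (c a b)]
      · simp [hB, ind]
      · intro r _ hr
        simp [hB, ind, hr.symm]
      · simp
    rw [Matrix.map_apply, e1]
    simp only [hJ, hD, ind, Matrix.sub_apply, triv]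
    by_cases k : a = b
    · subst k
      simp [hE.refl_iff]
    · simp [k]
  have hJJ : J * J = 0 := by
    ext a b
    rw [Matrix.mul_apply]
    by_cases k : E a b
    · have e1 : ∀ w, J a w * J w b = if E a w then 1 else 0 := by
        intro w
        by_cases k' : E a w
        · have : E w b := hE.trans (hE.symm k') k
          simp [hJ, ind, k', this]
        · simp [hJ, ind, k']
      rw [Finset.sum_congr rfl fun w _ => e1 w]
      rw [Finset.sum_boole]
      change ((deg E a : ℕ) : ZMod (n + 1)) = 0
      rw [h.deg_eq hE.coh (hE.left k)]
      exact (ZMod.natCast_eq_zero_iff _ _).2 hqd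
    · apply Finset.sum_eq_zero
      intro w _
      simp only [hJ, ind]
      by_cases k1 : E a w
      · by_cases k2 : E w b
        · exact absurd (hE.trans k1 k2) k
        · simp [k2]
      · simp [k1]
  have hDdiag : D = Matrix.diagonal (fun a => if c a a = c o o then 1 else 0) := by
    ext a b
    by_cases k : a = b
    · subst k; simp [hD, ind, triv]
    · simp [hD, ind, triv, k]
  have hJD : J * D = J := by
    ext a b
    rw [hDdiag, Matrix.mul_diagonal]
    by_cases k : E a b
    · simp [hE.right k]
    · simp [hJ, ind, k]
  have hDJ : D * J = J := by
    ext a b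
    rw [hDdiag, Matrix.diagonal_mul]
    by_cases k : E a b
    · simp [hE.left k]
    · simp [hJ, ind, k]
  have hDD : D * D = D := by
    rw [hDdiag, Matrix.diagonal_mul_diagonal]
    congr 1
    ext a
    simp
  have hpow : ∀ k : ℕ, (J - D) ^ (k + 1) =
      ((-1) ^ (k + 1) : ZMod (n + 1)) • (D - ((k + 1 : ℕ) : ZMod (n + 1)) • J) := by
    intro k
    induction k with
    | zero => simp
    | succ k ih =>
      rw [pow_succ, ih, smul_mul_assoc, sub_mul, smul_mul_assoc, mul_sub, mul_sub, hDJ, hDD, hJJ,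
        hJD, pow_succ (-1 : ZMod (n + 1)) (k + 1), mul_smul]
      congr 1
      push_cast
      module
  have hfin : ((∑ r, B r) ^ (n + 1)).map (Nat.castRingHom (ZMod (n + 1))) = - D := by
    rw [Matrix.map_pow, hM, hpow]
    have e0 : (((n + 1 : ℕ) : ZMod (n + 1))) = 0 := ZMod.natCast_self _
    rw [e0, hodd.neg_one_pow]
    simp
  have := congrFun (congrFun hfin o) o
  rw [Matrix.map_apply] at this
  simp only [Nat.coe_castRingHom, hcast, hD, Matrix.neg_apply, ind, triv] at this
  simp at this

theorem CC.is2_of_bip [Fintype ι] (h : CC c) {o : V}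
    (bip : ∀ u v, u ≠ v → ∃ g : V → ZMod 2, ∀ a b, c a b = c u v → g a ≠ g b)
    (E : V → V → Prop) : Per c o E → Is2 c o E := by
  induction E using WellFoundedLT.induction with
  | ind E ih =>
  intro hE
  refine ⟨h.frob hE bip, ?_⟩
  intro u v huv
  by_cases hne : u = v
  · subst hne
    refine ⟨0, ?_⟩
    unfold deg
    rw [pow_zero, Finset.card_eq_one]
    refine ⟨u, ?_⟩
    ext w
    simp only [Finset.mem_filter, Finset.mem_univ, true_and, Finset.mem_singleton]
    exact ⟨fun k => (h.diag k.symm rfl).symm, fun k => by rw [k]⟩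
  obtain ⟨g, hg⟩ := bip u v hne
  set G : V → V → Prop := fun a b => c a b = c u v ∨ c b a = c u v with hG
  have Gg : ∀ {a b}, G a b → g a ≠ g b := by
    rintro a b (k | k)
    · exact hg _ _ k
    · exact (hg _ _ k).symm
  have Gc : Coh c G := by
    apply Coh.of_imp
    rintro x y x' y' e (k | k)
    · exact Or.inl (e ▸ k)
    · exact Or.inr (h.symm e ▸ k)
  have Gs : ∀ {a b}, G a b → G b a := fun k => k.symm
  have GE : ∀ {a b}, G a b → E a b := by
    rintro a b (k | k)
    · exact hE.coh.imp k.symm huv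
    · exact hE.symm (hE.coh.imp k.symm huv)
  have z2 : ∀ a b d a' b' d' : ZMod 2, b ≠ d → b' ≠ d' → (a = b ↔ a' = b') → (a = d ↔ a' = d') := by
    decide
  have tr : ∀ {a b}, Relation.ReflTransGen G a b → ∀ a' b', c a b = c a' b' →
      Relation.ReflTransGen G a' b' ∧ (g a = g b ↔ g a' = g b') := by
    intro a b hab
    induction hab with
    | refl =>
      intro a' b' e
      obtain rfl := h.diag e rfl
      exact ⟨Relation.ReflTransGen.refl, by simp⟩
    | @tail m b h1 h2 ih =>
      intro a' b' e
      obtain ⟨m', e1, e2⟩ := h.path (w := m) e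
      obtain ⟨i1, i2⟩ := ih a' m' e1.symm
      have h3 : G m' b' := Gc.imp e2.symm h2
      exact ⟨i1.tail h3, z2 _ _ _ _ _ _ (Gg h2) (Gg h3) i2⟩
  set H : V → V → Prop := fun a b => c a a = c o o ∧ Relation.ReflTransGen G a b with hH
  have HE : ∀ {a b}, H a b → E a b := by
    rintro a b ⟨h1, h2⟩
    induction h2 with
    | refl => exact hE.refl_iff.2 h1
    | tail _ h3 ih => exact hE.trans ih (GE h3)
  have Hs : ∀ {a b}, H a b → H b a := by
    intro a b k
    refine ⟨hE.right (HE k), ?_⟩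
    have := k.2
    have sy : Std.Symm G := ⟨fun _ _ k => Gs k⟩
    exact (Relation.ReflTransGen.stdSymm).symm _ _ this
  have perH : Per c o H := by
    refine ⟨?_, Hs, fun k1 k2 => ⟨k1.1, k1.2.trans k2.2⟩, ?_⟩
    · apply Coh.of_imp
      rintro x y x' y' e ⟨k1, k2⟩
      exact ⟨h.fib_left e ▸ k1, (tr k2 _ _ e).1⟩
    · intro x
      exact ⟨fun k => k.1, fun k => ⟨k, Relation.ReflTransGen.refl⟩⟩
  have Huv : H u v := ⟨hE.left huv, Relation.ReflTransGen.single (Or.inl rfl)⟩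
  by_cases hHE : E ≤ H
  · -- `H = E`
    have hEH : ∀ {a b}, E a b → H a b := fun {a b} k => hHE a b k
    set F : V → V → Prop := fun a b => H a b ∧ g a = g b with hF
    have FE : ∀ {a b}, F a b → E a b := fun k => HE k.1
    have perF : Per c o F := by
      refine ⟨?_, fun k => ⟨Hs k.1, k.2.symm⟩,
        fun k1 k2 => ⟨perH.trans k1.1 k2.1, k1.2.trans k2.2⟩, ?_⟩
      · apply Coh.of_imp
        rintro x y x' y' e ⟨k1, k2⟩
        exact ⟨perH.coh.imp e k1, (tr k1.2 _ _ e).2.1 k2⟩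
      · intro x
        rw [← perH.refl_iff]
        exact ⟨fun k => k.1, fun k => ⟨k, rfl⟩⟩
    have z3 : ∀ a b d : ZMod 2, a ≠ b → a ≠ d → b = d := by decide
    have two : ∀ {a b d}, E a b → E a d → ¬ F a b → ¬ F a d → F b d := by
      intro a b d h1 h2 h3 h4
      refine ⟨hEH (hE.trans (hE.symm h1) h2), z3 (g a) _ _ ?_ ?_⟩
      · exact fun k => h3 ⟨hEH h1, k⟩
      · exact fun k => h4 ⟨hEH h2, k⟩
    have huvF : ¬ F u v := fun k => hg u v rfl k.2
    have hlt : F < E := by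
      refine lt_of_le_not_ge (fun a b k => FE k) (fun k => huvF (k u v huv))
    have is2F := ih F hlt perF
    have hdv := h.tower_double perF is2F (c u v)
    have hu : c u u = c o o := hE.left huv
    rw [← h.deg_eq (coh_col _) hu, ← h.deg_eq (h.coh_rc perF.coh (coh_col _)) hu] at hdv
    have hdeg : deg (rc F (fun a b => c a b = c u v)) u = deg F o := by
      rw [← h.deg_eq perF.coh (hE.right huv)]
      unfold deg
      congr 1
      ext w
      simp only [Finset.mem_filter, Finset.mem_univ, true_and]
      constructor
      · rintro ⟨a, k1, k2⟩
        have k3 : E a w := hE.coh.imp k2.symm huv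
        have k4 : ¬ F a w := fun k => huvF (perF.coh.imp k2 k)
        refine two (hE.trans (hE.symm (FE k1)) huv) k3 (fun k => huvF (perF.trans k1 k)) k4
      · intro k
        have k1 : c v v = c w w := (perF.left k).trans (perF.right k).symm
        obtain ⟨a, -, k2⟩ := (h.coh_rc coh_true (coh_col (c u v))).imp k1 ⟨u, trivial, rfl⟩
        have k3 : E a w := hE.coh.imp k2.symm huv
        have k4 : ¬ F a w := fun k => huvF (perF.coh.imp k2 k)
        refine ⟨a, ?_, k2⟩
        refine two (hE.symm (hE.trans huv (FE k))) (hE.symm k3) ?_ ?_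
        · exact fun k' => huvF (perF.symm (perF.trans k k'))
        · exact fun k' => k4 (perF.symm k')
    exact is2F.1.of_dvd (hdeg ▸ hdv)
  · have hlt : H < E := lt_of_le_not_ge (fun a b k => HE k) hHE
    exact (ih H hlt perH).2 u v Huv

theorem CC.main [Fintype ι] (h : CC c) :
    (∀ u v, P2 (Finset.univ.filter fun p : V × V => c p.1 p.2 = c u v).card) ↔
    ∀ u v, ∃ g : V → ZMod 2, ∀ a b, a ≠ b → c a b = c u v → g a ≠ g b := by
  constructor
  · intro hp u v
    by_cases hne : u = v
    · subst hne
      exact ⟨0, fun a b k e => absurd (h.diag e.symm rfl) k⟩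
    by_cases hf : c v v = c u u
    · have is2 : Is2 c u (full c u) := by
        refine ⟨?_, ?_⟩
        · rw [deg_full]
          refine (hp u u).of_dvd ?_
          rw [h.card_color]
          exact dvd_mul_right _ _
        · intro a b _
          refine (hp a b).of_dvd ?_
          rw [h.card_color]
          exact dvd_mul_left _ _
      obtain ⟨g, hg⟩ := h.tower_color (h.per_full u) is2 u v ⟨rfl, hf⟩ hne
      exact ⟨g, fun a b _ e => hg a b e⟩
    · refine ⟨fun a => if c a a = c u u then 1 else 0, fun a b _ e => ?_⟩
      have h1 := h.fib_left e
      have h2 := h.fib_right e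
      simp [h1, h2, hf]
  · intro hb
    have bip : ∀ u v, u ≠ v → ∃ g : V → ZMod 2, ∀ a b, c a b = c u v → g a ≠ g b := by
      intro u v huv
      obtain ⟨g, hg⟩ := hb u v
      exact ⟨g, fun a b e => hg a b (fun k => huv (h.diag e k)) e⟩
    have is2 : ∀ o, Is2 c o (full c o) := fun o => h.is2_of_bip bip _ (h.per_full o)
    intro u v
    rw [h.card_color]
    have hX := (is2 u).1
    have hY := (is2 v).1
    rw [deg_full] at hX hY
    refine hX.mul (hY.of_dvd ?_)
    convert h.tower_double (h.per_full u) (is2 u) (c u v) using 1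
    unfold deg
    congr 1
    ext w
    simp only [Finset.mem_filter, Finset.mem_univ, true_and]
    constructor
    · intro k
      obtain ⟨a, -, k2⟩ := (h.coh_rc coh_true (coh_col (c u v))).imp k.symm ⟨u, trivial, rfl⟩
      exact ⟨a, ⟨rfl, h.fib_left k2⟩, k2⟩
    · rintro ⟨a, -, k2⟩
      exact h.fib_right k2

end TS

/-- Corollary 1.2: a coherent configuration is a 2-scheme iff every basis graph
is bipartite. -/
theorem twoScheme_iff_bipartite {V : Type*} [Fintype V] (C : CoherentConfig V) :
    IsPSchemeCC 2 C ↔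
      ∀ S ∈ C.classes, ∃ g : V → ZMod 2,
        ∀ u v : V, u ≠ v → ((u, v) ∈ S ∨ (v, u) ∈ S) → g u ≠ g v := by
  classical
  choose c' hc' huniq using C.part
  let c : V → V → Set (V × V) := fun a b => c' (a, b)
  have hc : ∀ R ∈ C.classes, ∀ a b, (a, b) ∈ R ↔ c a b = R := by
    intro R hR a b
    constructor
    · intro k
      exact (huniq (a, b) R ⟨hR, k⟩).symm
    · rintro rfl
      exact (hc' (a, b)).2
  have hmem : ∀ a b, c a b ∈ C.classes := fun a b => (hc' (a, b)).1
  have hself : ∀ a b, (a, b) ∈ c a b := fun a b => (hc' (a, b)).2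
  have h : TS.CC c := by
    refine ⟨?_, ?_, ?_⟩
    · intro x y x' y' e hxy
      obtain ⟨D, hD, hd⟩ := C.diag_union
      have h1 : (x, y) ∈ diag V := hxy
      rw [hd] at h1
      obtain ⟨R, hR, hxR⟩ := h1
      have h2 : c x' y' = R := e ▸ (hc R (hD hR) x y).1 hxR
      have h3 : (x', y') ∈ diag V := by
        rw [hd]
        exact ⟨R, hR, (hc R (hD hR) x' y').2 h2⟩
      exact h3
    · intro x y x' y' e
      have h1 := C.transp_mem _ (hmem x y)
      have h2 : (y, x) ∈ transp (c x y) := hself x y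
      have h3 : (y', x') ∈ transp (c x y) := by
        rw [e]; exact hself x' y'
      rw [(hc _ h1 y x).1 h2, (hc _ h1 y' x').1 h3]
    · intro x y x' y' e r s
      by_cases hr : r ∈ C.classes
      · by_cases hs : s ∈ C.classes
        · have := C.inter r hr s hs (c x y) (hmem x y) (x, y) (hself x y) (x', y')
            (e ▸ hself x' y')
          simp only [hc r hr, hc s hs] at this
          rw [Set.ncard_eq_toFinset_card', Set.ncard_eq_toFinset_card'] at this
          convert this using 2 <;> ext <;> simp
        · rw [Finset.filter_false_of_mem, Finset.filter_false_of_mem]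
          · rintro w - ⟨-, k⟩
            exact hs (k ▸ hmem _ _)
          · rintro w - ⟨-, k⟩
            exact hs (k ▸ hmem _ _)
      · rw [Finset.filter_false_of_mem, Finset.filter_false_of_mem]
        · rintro w - ⟨k, -⟩
          exact hr (k ▸ hmem _ _)
        · rintro w - ⟨k, -⟩
          exact hr (k ▸ hmem _ _)
  have hcard : ∀ u v, (c u v).ncard = (Finset.univ.filter fun p : V × V => c p.1 p.2 = c u v).card := by
    intro u v
    rw [Set.ncard_eq_toFinset_card']
    congr 1
    ext ⟨a, b⟩
    simp [hc _ (hmem u v)]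
  have hex : ∀ R ∈ C.classes, ∃ u v, R = c u v := by
    intro R hR
    obtain ⟨⟨u, v⟩, huv⟩ := C.nonempty_mem R hR
    exact ⟨u, v, ((hc R hR u v).1 huv).symm⟩
  have main := h.main
  constructor
  · intro hp S hS
    obtain ⟨u, v, rfl⟩ := hex S hS
    obtain ⟨g, hg⟩ := main.1 (fun a b => by
      obtain ⟨k, hk⟩ := hp _ (hmem a b)
      refine ⟨k, ?_⟩
      rw [← hk, hcard]
      congr) u v
    refine ⟨g, fun a b hab hS => ?_⟩
    rcases hS with k | k
    · exact hg a b hab ((hc _ (hmem u v) a b).1 k)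
    · exact (hg b a hab.symm ((hc _ (hmem u v) b a).1 k)).symm
  · intro hb R hR
    obtain ⟨u, v, rfl⟩ := hex R hR
    obtain ⟨k, hk⟩ := main.2 (fun a b => by
      obtain ⟨g, hg⟩ := hb _ (hmem a b)
      exact ⟨g, fun p q hpq e => hg p q hpq (Or.inl ((hc _ (hmem a b) p q).2 e))⟩) u v
    refine ⟨k, ?_⟩
    rw [← hk, hcard]
    congr
end
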